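/- arXiv:2004.08894 — 3 statements merged into one kernel-verified Lean document; each statement's English description precedes it below -/
import Mathlib

section
/- Let ν, λ be real numbers with 2λ not a nonpositive integer. For -1 < x < 1 and |z| < 1 sufficiently small, (1 - xz)^{-ν} · ₂F₁(ν/2, (ν+1)/2; λ + 1/2; z²(x² - 1)/(1 - xz)²) = Σ_{k=0}^{∞} ((ν)_k / (2λ)_k) C_k^λ(x) z^k. -/
/-- Gegenbauer (ultraspherical) polynomials `C_k^l(x)`, via the standard recurrence
(equivalent to the generating relation `(1-2xz+z^2)^(-l) = ∑ C_k^l(x) z^k`). -/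
noncomputable def gegenbauer : Nat -> Real -> Real -> Real
  | 0, _, _ => 1
  | 1, l, x => 2 * l * x
  | (k+2), l, x =>
      (2 * (l + (k:Real) + 1) * x * gegenbauer (k+1) l x
        - ((k:Real) + 2*l) * gegenbauer k l x) / ((k:Real) + 2)

/-- Pochhammer symbol (rising factorial). -/
noncomputable def poch (a : Real) (k : Nat) : Real := (ascPochhammer Real k).eval a

/-- Gauss hypergeometric function 2F1. -/
noncomputable def hyperg (a b c z : Real) : Real :=
  ∑' k : Nat, poch a k * poch b k / (poch c k * (Nat.factorial k)) * z ^ k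


lemma hs_congr {f g : ℕ → ℝ} {a : ℝ} (h : HasSum f a) (e : ∀ k, g k = f k) : HasSum g a := by
  rwa [show g = f from funext e]

lemma poch_zero (a : ℝ) : poch a 0 = 1 := by simp [poch]

lemma poch_succ (a : ℝ) (k : ℕ) : poch a (k+1) = poch a k * (a + k) := by
  simp [poch, ascPochhammer_succ_eval]

lemma poch_add (a : ℝ) (i m : ℕ) : poch a (i+m) = poch a i * poch (a+i) m := by
  induction m with
  | zero => simp [poch_zero]
  | succ m ih => rw [← add_assoc, poch_succ, ih, poch_succ]; push_cast; ring

lemma poch_double (a : ℝ) (j : ℕ) :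
    poch a (2*j) = 4^j * (poch (a/2) j * poch ((a+1)/2) j) := by
  induction j with
  | zero => simp [poch_zero]
  | succ j ih =>
    rw [show 2*(j+1) = 2*j+1+1 by ring, poch_succ, poch_succ, ih, poch_succ, poch_succ]
    push_cast; ring

lemma poch_abs_le (a N : ℝ) (h : |a| ≤ N) (k : ℕ) : |poch a k| ≤ poch N k := by
  induction k with
  | zero => simp [poch_zero]
  | succ k ih =>
    rw [poch_succ, poch_succ, abs_mul]
    have h1 : |a + k| ≤ N + k := by
      refine (abs_add_le _ _).trans ?_
      simpa using h
    exact mul_le_mul ih h1 (abs_nonneg _) ((abs_nonneg _).trans ih)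

lemma poch_ne_zero (a : ℝ) (h : ∀ m : ℕ, a ≠ -(m:ℝ)) (k : ℕ) : poch a k ≠ 0 := by
  induction k with
  | zero => simp [poch_zero]
  | succ k ih =>
    rw [poch_succ]
    refine mul_ne_zero ih fun h' => h k ?_
    linarith

lemma binom_hasSum (a y : ℝ) (hy : |y| < 1) :
    HasSum (fun m : ℕ => poch a m / m.factorial * y^m) ((1-y)^(-a)) := by
  have h := (Real.one_div_one_sub_rpow_hasFPowerSeriesOnBall_zero a).hasSum (y := y)
    (by simpa [enorm_eq_nnnorm] using! hy)
  have h0 : 0 ≤ 1 - y := by have := (abs_lt.mp hy).2; linarith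
  rw [Real.rpow_neg h0]
  simp only [zero_add, one_div] at h
  refine hs_congr h fun m => ?_
  have key : poch a m = m.factorial * Ring.choose (a + m - 1) m := by
    rw [Ring.choose, ← nsmul_eq_mul, Ring.factorial_nsmul_multichoose_eq_ascPochhammer,
      Polynomial.ascPochhammer_smeval_eq_eval]
    rw [show a + (m:ℝ) - 1 - m + 1 = a by ring, poch]
  rw [key]
  have : (m.factorial : ℝ) ≠ 0 := by positivity
  simp
  field_simp

/-- Even series coefficients. -/
noncomputable def bb (c y : ℝ) (i : ℕ) : ℝ :=
  if Even i then y^(i/2) / (4^(i/2) * (i/2).factorial * poch c (i/2)) else 0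

lemma bb_even (c y : ℝ) (j : ℕ) : bb c y (2*j) = y^j / (4^j * j.factorial * poch c j) := by
  simp [bb]

lemma bb_odd (c y : ℝ) (j : ℕ) : bb c y (2*j+1) = 0 := by
  simp [bb]

lemma bb_rec (l y : ℝ) (hc : ∀ m : ℕ, l + 1/2 ≠ -(m:ℝ)) (i : ℕ) :
    ((i:ℝ)+2) * (i + 1 + 2 * l) * bb (l+1/2) y (i+2) = y * bb (l+1/2) y i := by
  rcases Nat.even_or_odd' i with ⟨j, rfl | rfl⟩
  · rw [show 2*j+2 = 2*(j+1) by ring, bb_even, bb_even, poch_succ, Nat.factorial_succ]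
    have h1 := poch_ne_zero _ hc j
    have h2 : l + 1/2 + j ≠ 0 := fun h => hc j (by linarith)
    have h2' : l * 2 + 1 + 2 * j ≠ 0 := fun h => hc j (by linarith)
    have h3 : (j.factorial : ℝ) ≠ 0 := by positivity
    push_cast
    rw [mul_div_assoc', mul_div_assoc', div_eq_div_iff (by positivity) (by positivity)]
    ring
  · rw [show 2*j+1+2 = 2*(j+1)+1 by ring, bb_odd, bb_odd]; simp

open PowerSeries in
lemma gegen_rec (l x : ℝ) (hc : ∀ m : ℕ, l + 1/2 ≠ -(m:ℝ)) (a : ℕ → ℝ)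
    (ha : ∀ k, a k = ∑ p ∈ Finset.HasAntidiagonal.antidiagonal k,
      bb (l+1/2) (x^2-1) p.1 * (x^p.2 / p.2.factorial)) (k : ℕ) :
    ((k:ℝ)+2) * (2*l+k+1) * a (k+2) = 2 * (l+k+1) * x * a (k+1) - a k := by
  set B : ℝ⟦X⟧ := PowerSeries.mk (bb (l+1/2) (x^2-1)) with hB
  set E : ℝ⟦X⟧ := PowerSeries.mk (fun m => x^m / m.factorial) with hE
  have hF : ∀ k, coeff k (B * E) = a k := by
    intro k; rw [ha, coeff_mul]; simp [hB, hE]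
  have dE : d⁄dX ℝ E = C x * E := by
    ext n
    rw [coeff_derivative, coeff_C_mul, hE, coeff_mk, coeff_mk, Nat.factorial_succ]
    have : (n.factorial : ℝ) ≠ 0 := by positivity
    push_cast
    field_simp
    ring
  have dB : X * d⁄dX ℝ (d⁄dX ℝ B) + C (2*l) * d⁄dX ℝ B = C (x^2-1) * (X * B) := by
    ext n
    rcases n with _ | n
    · have h1 : bb (l+1/2) (x^2-1) 1 = 0 := bb_odd _ _ 0
      rw [map_add, coeff_C_mul, coeff_C_mul, coeff_derivative, hB, coeff_mk]
      simp only [zero_add, h1]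
      simp
    · simp only [map_add, coeff_succ_X_mul, coeff_C_mul, coeff_derivative, hB, coeff_mk]
      have := bb_rec l (x^2-1) hc n
      push_cast
      linear_combination this
  have hode : X * d⁄dX ℝ (d⁄dX ℝ (B*E)) + C (2*l) * d⁄dX ℝ (B*E)
      = C (2*x) * (X * d⁄dX ℝ (B*E)) + C (2*l*x) * (B*E) - X * (B*E) := by
    simp only [Derivation.leibniz, smul_eq_mul, dE, map_add, derivative_C, mul_zero]
    have e0 : (C (2:ℝ) : ℝ⟦X⟧) = 2 := map_ofNat _ 2
    have e1 : (C (x^2-1) : ℝ⟦X⟧) = C x * C x - 1 := by simp [pow_two]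
    have e2 : (C (2*x) : ℝ⟦X⟧) = 2 * C x := by simp [e0]
    have e3 : (C (2*l) : ℝ⟦X⟧) = 2 * C l := by simp [e0]
    have e4 : (C (2*l*x) : ℝ⟦X⟧) = 2 * C l * C x := by simp [e0]
    rw [e1, e3] at dB
    rw [e2, e3, e4]
    linear_combination E * dB
  have := congrArg (coeff (k+1)) hode
  simp only [map_add, map_sub, coeff_succ_X_mul, coeff_C_mul, coeff_derivative, hF] at this
  push_cast at this
  linear_combination this

lemma gegen_formula (l x : ℝ) (hl : ∀ m : ℕ, 2*l ≠ -(m:ℝ)) (k : ℕ) :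
    gegenbauer k l x = poch (2*l) k * ∑ p ∈ Finset.HasAntidiagonal.antidiagonal k,
      bb (l+1/2) (x^2-1) p.1 * (x^p.2 / p.2.factorial) := by
  have hc : ∀ m : ℕ, l + 1/2 ≠ -(m:ℝ) := by
    intro m h
    apply hl (2*m+1)
    push_cast; linarith
  obtain ⟨a, ha⟩ : ∃ a : ℕ → ℝ, ∀ k, a k = ∑ p ∈ Finset.HasAntidiagonal.antidiagonal k,
      bb (l+1/2) (x^2-1) p.1 * (x^p.2 / p.2.factorial) := ⟨_, fun _ => rfl⟩
  rw [← ha]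
  have hrec := gegen_rec l x hc a ha
  have h0 : a 0 = 1 := by rw [ha]; simp [bb, poch_zero]
  have h1 : a 1 = x := by
    rw [ha]; simp [bb, poch_zero, Finset.Nat.antidiagonal_succ]
  induction k using Nat.strong_induction_on with
  | _ k ih =>
    match k with
    | 0 => simp [gegenbauer, poch_zero, h0]
    | 1 => simp [gegenbauer, poch_succ, poch_zero, h1]
    | k+2 =>
      rw [gegenbauer, ih (k+1) (by omega), ih k (by omega)]
      rw [div_eq_iff (by positivity), poch_succ _ (k+1), poch_succ _ k]
      push_cast
      linear_combination (-(poch (2*l) k * (2*l+k))) * hrec k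

lemma hyp_summable (A B c w : ℝ) (hA : 0 < A) (hB : 0 < B) (hc : ∀ m : ℕ, c ≠ -(m:ℝ))
    (hw0 : 0 ≤ w) (hw : w ≤ 1/4) :
    Summable fun j : ℕ => poch A j * poch B j / (|poch c j| * j.factorial) * w^j := by
  refine summable_of_ratio_norm_eventually_le (r := 1/2) (by norm_num) ?_
  filter_upwards [Filter.eventually_ge_atTop ⌈10 * (A + B + |c|)⌉₊] with j hj
  have hj' : 10 * (A + B + |c|) ≤ j := Nat.ceil_le.mp hj
  have hcj : c + j ≠ 0 := fun h => hc j (by linarith)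
  have hP := poch_ne_zero c hc j
  have e : poch A (j+1) * poch B (j+1) / (|poch c (j+1)| * (j+1).factorial) * w^(j+1)
      = ((A+j)*(B+j)/(|c+j| * (j+1)) * w) * (poch A j * poch B j / (|poch c j| * j.factorial) * w^j) := by
    rw [poch_succ, poch_succ, poch_succ, Nat.factorial_succ, abs_mul]
    have h1 : |poch c j| ≠ 0 := abs_ne_zero.mpr hP
    have h2 : |c + j| ≠ 0 := abs_ne_zero.mpr hcj
    have h3 : (j.factorial : ℝ) ≠ 0 := by positivity
    push_cast
    field_simp
    ring
  rw [e, norm_mul]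
  refine mul_le_mul_of_nonneg_right ?_ (norm_nonneg _)
  rw [Real.norm_of_nonneg (by positivity)]
  have h4 : (A+j)*(B+j)/(|c+j| * (j+1)) ≤ 2 := by
    have hcp : 0 < |c + j| := abs_pos.mpr hcj
    rw [div_le_iff₀ (by positivity)]
    have h5 : (9/10:ℝ) * j ≤ |c+j| := by
      have := neg_abs_le c
      have := le_abs_self (c+j)
      have := abs_nonneg c
      linarith
    have h6 : A + j ≤ 11/10 * j := by have := abs_nonneg c; linarith
    have h7 : B + j ≤ 11/10 * j := by have := abs_nonneg c; linarith
    have hj0 : (0:ℝ) ≤ j := by positivity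
    have h8 := mul_le_mul h6 h7 (by positivity) (by positivity)
    have h9 := mul_le_mul h5 (show (j:ℝ) ≤ j + 1 by linarith) hj0 hcp.le
    nlinarith
  nlinarith

lemma even_term (a r Y z P : ℝ) (hr : 0 < r) (hP : P ≠ 0) (j : ℕ) :
    poch a (2*j) * (Y^j / (4^j * j.factorial * P)) * z^(2*j) * r^(-(a + ((2*j : ℕ):ℝ)))
      = r^(-a) * (poch (a/2) j * poch ((a+1)/2) j / (P * j.factorial) * (z^2*Y/r^2)^j) := by
  rw [neg_add, Real.rpow_add hr, Real.rpow_neg hr.le ((2*j : ℕ):ℝ), Real.rpow_natCast, poch_double,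
    div_pow, mul_pow, ← pow_mul, ← pow_mul]
  have h3 : (j.factorial : ℝ) ≠ 0 := by positivity
  have h4 : r ≠ 0 := hr.ne'
  field_simp

lemma two_inj : Function.Injective (fun j : ℕ => 2 * j) := fun a b h => by
  simpa using h

lemma not_range_bb (c y : ℝ) (i : ℕ) (hi : i ∉ Set.range (fun j : ℕ => 2 * j)) : bb c y i = 0 := by
  rcases Nat.even_or_odd' i with ⟨j, rfl | rfl⟩
  · exact absurd ⟨j, rfl⟩ hi
  · exact bb_odd _ _ _

lemma inner_hasSum (a b x z : ℝ) (h : |x*z| < 1) (i : ℕ) :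
    HasSum (fun m : ℕ => poch a (i+m) * (b * (x^m / m.factorial)) * z^(i+m))
      (poch a i * b * z^i * (1 - x*z)^(-(a+i))) := by
  refine hs_congr ((binom_hasSum (a+i) (x*z) h).mul_left (poch a i * b * z^i)) fun m => ?_
  rw [poch_add, pow_add, mul_pow]
  ring

lemma G_summable (N c y x z : ℝ) (hN : 0 < N) (hc : ∀ m : ℕ, c ≠ -(m:ℝ)) (hx : |x| < 1)
    (hy : |y| ≤ 1) (hz : |z| < 1/3) :
    Summable fun p : ℕ × ℕ =>
      poch N (p.1+p.2) * (|bb c y p.1| * (|x|^p.2 / p.2.factorial)) * |z|^(p.1+p.2) := by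
  have hq : |x| * |z| < 1/3 := by nlinarith [abs_nonneg x, abs_nonneg z]
  have hq0 : 0 ≤ |x| * |z| := by positivity
  have hin := fun i => inner_hasSum N (|bb c y i|) (|x|) (|z|)
    (by rw [abs_of_nonneg hq0]; linarith) i
  have hpos : ∀ k, 0 ≤ poch N k := fun k =>
    (abs_nonneg _).trans (poch_abs_le N N (abs_of_pos hN).le k)
  rw [summable_prod_of_nonneg]
  · refine ⟨fun i => (hin i).summable, ?_⟩
    simp only [(hin _).tsum_eq]
    rw [← two_inj.summable_iff]
    · have hr : 0 < 1 - |x| * |z| := by linarith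
      have hs := (hyp_summable (N/2) ((N+1)/2) c (|z|^2*|y|/(1-|x| * |z|)^2) (by positivity)
        (by positivity) hc (by positivity) (by
          rw [div_le_iff₀ (by positivity)]
          have : |z|^2 ≤ (1/3)^2 := pow_le_pow_left₀ (abs_nonneg _) hz.le 2
          nlinarith [abs_nonneg y, abs_nonneg z])).mul_left ((1 - |x| * |z|)^(-N))
      refine hs.congr fun j => ?_
      have := even_term N (1 - |x| * |z|) (|y|) (|z|) (|poch c j|) hr
        (abs_ne_zero.mpr (poch_ne_zero c hc j)) j
      rw [← this]
      simp only [Function.comp]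
      rw [bb_even, abs_div, abs_pow, abs_mul,
        abs_of_pos (show (0:ℝ) < 4^j * j.factorial by positivity)]
    · intro i hi
      simp [not_range_bb c y i hi]
  · intro p
    have := hpos (p.1+p.2)
    simp only [Pi.zero_apply]
    positivity

lemma antidiag_hasSum (F : ℕ × ℕ → ℝ) (S : ℝ) (h : HasSum F S) :
    HasSum (fun k => ∑ p ∈ Finset.HasAntidiagonal.antidiagonal k, F p) S := by
  have h2 := (Finset.HasAntidiagonal.sigmaAntidiagonalEquivProd (A := ℕ)).hasSum_iff.mpr h
  refine h2.sigma fun k => ?_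
  have := hasSum_fintype (fun q : (Finset.HasAntidiagonal.antidiagonal k) => F q)
  rw [Finset.sum_coe_sort (Finset.HasAntidiagonal.antidiagonal k) F] at this
  exact this

theorem gegenbauer_hyperg_generating (ν l : Real) (hl : ∀ m : Nat, 2*l ≠ -(m:Real))
    (x : Real) (hx : x ∈ Set.Ioo (-1:Real) 1) :
    ∃ ε : Real, 0 < ε ∧ ε ≤ 1 ∧ ∀ z : Real, |z| < ε →
      HasSum (fun k : Nat => poch ν k / poch (2*l) k * gegenbauer k l x * z^k)
        ((1 - x*z) ^ (-ν)
          * hyperg (ν/2) ((ν+1)/2) (l + 1/2) (z^2 * (x^2 - 1) / (1 - x*z)^2)) := by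

  have hc : ∀ m : ℕ, l + 1/2 ≠ -(m:ℝ) := by
    intro m h
    apply hl (2*m+1)
    push_cast; linarith
  have hx1 : |x| < 1 := abs_lt.mpr ⟨hx.1, hx.2⟩
  have hy : |x^2 - 1| ≤ 1 := by
    have : x^2 < 1 := (sq_lt_one_iff_abs_lt_one x).mpr hx1
    rw [abs_le]; constructor <;> nlinarith [sq_nonneg x]
  refine ⟨1/3, by norm_num, by norm_num, fun z hz => ?_⟩
  have hq : |x*z| < 1/3 := by
    rw [abs_mul]; nlinarith [abs_nonneg x, abs_nonneg z]
  have hr : 0 < 1 - x*z := by have := (abs_lt.mp hq).2; linarith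
  set F : ℕ × ℕ → ℝ := fun p => poch ν (p.1+p.2) *
    (bb (l+1/2) (x^2-1) p.1 * (x^p.2 / p.2.factorial)) * z^(p.1+p.2) with hF
  have hFs : Summable F := by
    refine Summable.of_norm_bounded
      (G_summable (|ν|+1) (l+1/2) (x^2-1) x z (by positivity) hc hx1 hy hz) fun p => ?_
    simp only [hF, Real.norm_eq_abs, abs_mul, abs_pow, abs_div, Nat.abs_cast]
    gcongr
    exact poch_abs_le _ _ (by linarith) _
  have h1 := hFs.hasSum.prod_fiberwise fun i =>
    inner_hasSum ν (bb (l+1/2) (x^2-1) i) x z (by linarith) i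
  rw [← two_inj.hasSum_iff (by
    intro i hi
    rw [not_range_bb (l+1/2) (x^2-1) i hi]; simp)] at h1
  have h2 : ∑' p, F p = (1 - x*z) ^ (-ν)
      * hyperg (ν/2) ((ν+1)/2) (l + 1/2) (z^2 * (x^2 - 1) / (1 - x*z)^2) := by
    rw [← h1.tsum_eq, hyperg, ← tsum_mul_left]
    refine tsum_congr fun j => ?_
    rw [← even_term ν (1-x*z) (x^2-1) z _ hr (poch_ne_zero _ hc j) j]
    simp only [Function.comp]
    rw [bb_even]
  rw [← h2]
  convert antidiag_hasSum F _ hFs.hasSum using 1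
  funext k
  rw [gegen_formula l x hl k]
  have hP := poch_ne_zero _ hl k
  rw [div_mul_eq_mul_div, mul_div_assoc, mul_div_cancel_left₀ _ hP, Finset.mul_sum, Finset.sum_mul]
  refine Finset.sum_congr rfl fun p hp => ?_
  rw [Finset.HasAntidiagonal.mem_antidiagonal] at hp
  simp only [hF, hp]
end

section
/- Let u be a bounded harmonic function on the unit ball B_n of R^n, n ≥ 3. Then for every x ∈ B_n, |∇u(x)| ≤ C(x) · sup_{B_n} |u|, where C(x) = ((n-1)·vol_{n-1}(B_{n-1})/vol_n(B_n)) · (∫_{-1}^{1} |t - (n-2)|x|/n| (1-t²)^{(n-3)/2} (1 - 2t|x| + |x|²)^{-(n-2)/2} dt) · 1/(1 - |x|²). -/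
open MeasureTheory Real in
/-- k-dimensional Lebesgue measure of the unit ball in R^k. -/
noncomputable def unitBallVol (k : Nat) : Real :=
  (volume (Metric.ball (0 : EuclideanSpace Real (Fin k)) 1)).toReal

/-- u is harmonic on s: C^2 and the Laplacian vanishes on s. -/
def IsHarmonicOn {n : Nat} (u : EuclideanSpace Real (Fin n) -> Real)
    (s : Set (EuclideanSpace Real (Fin n))) : Prop :=
  ContDiffOn Real 2 u s /\ ∀ x ∈ s,
    (∑ i : Fin n, fderiv Real (fun y => fderiv Real u y (EuclideanSpace.single i 1)) x
      (EuclideanSpace.single i 1)) = 0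

namespace Khav
section DUI
open MeasureTheory Set Metric

theorem dui {S : Type*} [TopologicalSpace S] [CompactSpace S] [MeasurableSpace S] [BorelSpace S]
    (σ : Measure S) [IsFiniteMeasure σ] (F F' : ℝ → S → ℝ) (t0 δ : ℝ) (hδ : 0 < δ)
    (hF : ∀ t ∈ Icc (t0-δ) (t0+δ), Continuous (F t))
    (hF' : ContinuousOn (Function.uncurry F') (Icc (t0-δ) (t0+δ) ×ˢ univ))
    (hd : ∀ t ∈ Icc (t0-δ) (t0+δ), ∀ s, HasDerivAt (fun t => F t s) (F' t s) t) :
    HasDerivAt (fun t => ∫ s, F t s ∂σ) (∫ s, F' t0 s ∂σ) t0 := by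
  have hmem : Icc (t0-δ) (t0+δ) ∈ nhds t0 := Icc_mem_nhds (by linarith) (by linarith)
  have ht0 : t0 ∈ Icc (t0-δ) (t0+δ) := ⟨by linarith, by linarith⟩
  have hcomp : IsCompact (Icc (t0-δ) (t0+δ) ×ˢ (univ : Set S)) := isCompact_Icc.prod isCompact_univ
  obtain ⟨C, hC⟩ := hcomp.exists_bound_of_continuousOn hF'
  have hintegr : ∀ g : S → ℝ, Continuous g → Integrable g σ := fun g hg =>
    (hg.integrable_of_hasCompactSupport (HasCompactSupport.of_compactSpace g))
  have hF'0 : Continuous (F' t0) := by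
    have : F' t0 = Function.uncurry F' ∘ (fun s => (t0, s)) := rfl
    rw [this]
    exact hF'.comp_continuous (by fun_prop) (fun s => ⟨ht0, mem_univ _⟩)
  refine (hasDerivAt_integral_of_dominated_loc_of_deriv_le (bound := fun _ => C) hmem ?_
    (hintegr _ (hF _ ht0)) (hintegr _ hF'0).aestronglyMeasurable ?_ (integrable_const C) ?_).2
  · filter_upwards [hmem] with t ht using (hintegr _ (hF t ht)).aestronglyMeasurable
  · exact Filter.Eventually.of_forall fun s t ht => hC (t, s) ⟨ht, mem_univ _⟩
  · exact Filter.Eventually.of_forall fun s t ht => hd t ht s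
end DUI

section Polar
open MeasureTheory Set Metric Module
variable {E : Type*} [NormedAddCommGroup E] [InnerProductSpace ℝ E] [FiniteDimensional ℝ E]
  [MeasurableSpace E] [BorelSpace E] [Nontrivial E]

/-- surface measure -/
noncomputable abbrev sg (E : Type*) [NormedAddCommGroup E] [InnerProductSpace ℝ E]
  [FiniteDimensional ℝ E]
  [MeasurableSpace E] [BorelSpace E] : Measure (sphere (0:E) 1) := (volume : Measure E).toSphere

theorem polar_integral (f : E → ℝ) (hf : Integrable f) :
    ∫ x, f x = ∫ ω, (∫ r in Ioi (0:ℝ), r^(finrank ℝ E - 1) * f (r • (ω : E))) ∂(sg E) := by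
  set e := (homeomorphUnitSphereProd E) with he
  have hmp := (volume : Measure E).measurePreserving_homeomorphUnitSphereProd
  have hsymm : ∀ x : ({(0)}ᶜ : Set E), ((e x).2 : ℝ) • ((e x).1 : E) = x := by
    intro x
    have h0 : ‖(x:E)‖ ≠ 0 := norm_ne_zero_iff.2 x.2
    simp [he, smul_smul, mul_inv_cancel₀ h0]
  have hA : ∫ x, f x = ∫ x : ({(0)}ᶜ : Set E), f x.1 ∂((volume : Measure E).comap (↑)) := by
      rw [integral_subtype_comap (measurableSet_singleton _).compl fun x ↦ f x,
        restrict_compl_singleton]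
  have hI : Integrable (fun x : ({(0)}ᶜ : Set E) => f x.1) ((volume : Measure E).comap (↑)) := by
    have := (integrableOn_iff_comap_subtypeVal (μ := (volume : Measure E)) (f := f)
      (measurableSet_singleton (0:E)).compl).1 hf.integrableOn
    exact this
  have hB : ∫ x : ({(0)}ᶜ : Set E), f x.1 ∂((volume : Measure E).comap (↑)) =
      ∫ z, f ((z.2 : ℝ) • (z.1 : E)) ∂(sg E).prod (.volumeIoiPow (finrank ℝ E - 1)) := by
    rw [← hmp.integral_comp (Homeomorph.measurableEmbedding _)]
    simp only [← he, hsymm]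
  have hI2 : Integrable (fun z : sphere (0:E) 1 × Ioi (0:ℝ) => f ((z.2 : ℝ) • (z.1 : E)))
      ((sg E).prod (.volumeIoiPow (finrank ℝ E - 1))) := by
    rw [← hmp.integrable_comp_emb (Homeomorph.measurableEmbedding _)]
    simpa only [Function.comp_def, ← he, hsymm] using hI
  rw [hA, hB, integral_prod _ hI2]
  congr 1
  ext ω
  simp only [Measure.volumeIoiPow, ENNReal.ofReal]
  rw [integral_withDensity_eq_integral_smul,
        integral_subtype_comap measurableSet_Ioi
          fun a ↦ Real.toNNReal (a ^ (finrank ℝ E - 1)) • f (a • (ω:E)),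
        setIntegral_congr_fun measurableSet_Ioi fun x hx ↦ ?_]
  · rw [NNReal.smul_def, Real.coe_toNNReal _ (pow_nonneg hx.out.le _)]; rfl
  · exact (measurable_subtype_coe.pow_const _).real_toNNReal

end Polar
end Khav

namespace Khav
section Cone
open MeasureTheory Set Metric Module
open scoped RealInnerProductSpace
variable {E : Type*} [NormedAddCommGroup E] [InnerProductSpace ℝ E]

noncomputable def Dl (p : E) (τ : ℝ) (ω : E) : ℝ := √(τ^2 - ‖p‖^2 + ⟪p, ω⟫^2)
noncomputable def Ll (p : E) (τ : ℝ) (ω : E) : ℝ := Dl p τ ω - ⟪p, ω⟫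

theorem Dl_arg_pos {p : E} {τ : ℝ} (h : ‖p‖ < τ) (ω : E) : 0 < τ^2 - ‖p‖^2 + ⟪p, ω⟫^2 := by
  have : ‖p‖^2 < τ^2 := by gcongr
  nlinarith [sq_nonneg ⟪p, ω⟫]

theorem Dl_pos {p : E} {τ : ℝ} (h : ‖p‖ < τ) (ω : E) : 0 < Dl p τ ω :=
  Real.sqrt_pos.2 (Dl_arg_pos h ω)

theorem Dl_sq {p : E} {τ : ℝ} (h : ‖p‖ < τ) (ω : E) :
    Dl p τ ω ^ 2 = τ^2 - ‖p‖^2 + ⟪p, ω⟫^2 := Real.sq_sqrt (Dl_arg_pos h ω).le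

theorem Dl_neg (p : E) (τ : ℝ) (ω : E) : Dl p τ (-ω) = Dl p τ ω := by
  simp [Dl]

theorem abs_lt_Dl {p : E} {τ : ℝ} (h : ‖p‖ < τ) (ω : E) : |⟪p, ω⟫| < Dl p τ ω := by
  rw [← Real.sqrt_sq_eq_abs]
  apply Real.sqrt_lt_sqrt (sq_nonneg _)
  have : ‖p‖^2 < τ^2 := by gcongr
  linarith

theorem Ll_pos {p : E} {τ : ℝ} (h : ‖p‖ < τ) (ω : E) : 0 < Ll p τ ω := by
  have := abs_lt_Dl h ω
  unfold Ll
  linarith [le_abs_self ⟪p, ω⟫]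

theorem Ll_mul_neg {p : E} {τ : ℝ} (h : ‖p‖ < τ) (ω : E) :
    Ll p τ ω * Ll p τ (-ω) = τ^2 - ‖p‖^2 := by
  have := Dl_sq h ω
  simp only [Ll, Dl_neg, inner_neg_right]
  linear_combination this

theorem Ll_add_neg {p : E} {τ : ℝ} (ω : E) :
    Ll p τ ω + Ll p τ (-ω) = 2 * Dl p τ ω := by
  simp only [Ll, Dl_neg, inner_neg_right]
  ring

theorem norm_sq_ray (p ω : E) (hω : ‖ω‖ = 1) (r : ℝ) :
    ‖p + r • ω‖^2 = ‖p‖^2 + 2 * r * ⟪p, ω⟫ + r^2 := by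
  rw [norm_add_sq_real, inner_smul_right, norm_smul, hω]
  simp; ring

theorem norm_ray {p : E} {τ : ℝ} (h : ‖p‖ < τ) (ω : E) (hω : ‖ω‖ = 1) :
    ‖p + Ll p τ ω • ω‖ = τ := by
  have hτ : 0 ≤ τ := (norm_nonneg p).trans h.le
  rw [← sq_eq_sq₀ (norm_nonneg _) hτ, norm_sq_ray p ω hω]
  have := Dl_sq h ω
  simp only [Ll]
  linear_combination this

theorem ray_lt_iff {p : E} {τ : ℝ} (h : ‖p‖ < τ) (ω : E) (hω : ‖ω‖ = 1) {r : ℝ} (hr : 0 ≤ r) :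
    ‖p + r • ω‖ < τ ↔ r < Ll p τ ω := by
  have hτ : 0 ≤ τ := (norm_nonneg p).trans h.le
  rw [← sq_lt_sq₀ (norm_nonneg _) hτ, norm_sq_ray p ω hω]
  have h1 := Dl_sq h ω
  have h2 := abs_lt_Dl h ω
  have h3 := neg_abs_le ⟪p, ω⟫
  have h4 := Dl_pos h ω
  have h5 : 0 < r + ⟪p, ω⟫ + Dl p τ ω := by linarith
  unfold Ll
  constructor
  · intro hh
    by_contra hc
    push Not at hc
    nlinarith
  · intro hh
    nlinarith

variable [FiniteDimensional ℝ E] [MeasurableSpace E] [BorelSpace E] [Nontrivial E]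

theorem V_eq (f : E → ℝ) (hf : Continuous f) {p : E} {τ : ℝ} (h : ‖p‖ < τ) :
    ∫ x in ball (0:E) τ, f x =
      ∫ ω, (∫ r in (0:ℝ)..Ll p τ ω, r^(finrank ℝ E - 1) * f (p + r • (ω : E))) ∂(sg E) := by
  have hintegr : IntegrableOn f (ball (0:E) τ) :=
    (hf.continuousOn.integrableOn_compact (isCompact_closedBall (0:E) τ)).mono_set
      ball_subset_closedBall
  rw [← integral_indicator measurableSet_ball]
  rw [← integral_add_left_eq_self _ p]
  rw [polar_integral]
  · congr 1
    ext ω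
    have hω : ‖(ω:E)‖ = 1 := by simp
    rw [intervalIntegral.integral_of_le (Ll_pos h _).le, ← integral_Ioc_eq_integral_Ioo.symm,
      ← integral_indicator measurableSet_Ioi, ← integral_indicator measurableSet_Ioo]
    congr 1
    ext r
    by_cases hr : 0 < r
    · by_cases hr2 : r < Ll p τ ω
      · have := (ray_lt_iff h (ω:E) hω hr.le).2 hr2
        simp [indicator, hr, hr2, this]
      · have := mt (ray_lt_iff h (ω:E) hω hr.le).1 hr2
        simp [indicator, hr, hr2, this]
    · simp [indicator, hr]
  · have := (integrable_indicator_iff measurableSet_ball).2 hintegr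
    exact this.comp_add_left p

theorem V_deriv (f : E → ℝ) (hf : Continuous f) {p : E} (h : ‖p‖ < 1) :
    HasDerivAt (fun τ => ∫ x in ball (0:E) τ, f x)
      (∫ ω, Ll p 1 (ω:E) ^ (finrank ℝ E - 1) * f (p + Ll p 1 (ω:E) • (ω:E)) * (1 / Dl p 1 (ω:E))
        ∂(sg E)) 1 := by
  set δ := (1 - ‖p‖)/2 with hδ
  have hδ0 : 0 < δ := by linarith
  have hlt : ∀ τ ∈ Icc (1-δ) (1+δ), ‖p‖ < τ := fun τ hτ => by linarith [hτ.1]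
  have hDc : Continuous (fun z : ℝ × E => Dl p z.1 z.2) := by
    unfold Dl; fun_prop
  have hLc : Continuous (fun z : ℝ × E => Ll p z.1 z.2) := by
    unfold Ll; fun_prop
  have key := dui (sg E)
    (fun τ ω => ∫ r in (0:ℝ)..Ll p τ ω, r^(finrank ℝ E - 1) * f (p + r • (ω : E)))
    (fun τ ω => Ll p τ (ω:E) ^ (finrank ℝ E - 1) * f (p + Ll p τ (ω:E) • (ω:E)) * (τ / Dl p τ (ω:E)))
    1 δ hδ0 ?_ ?_ ?_
  · refine key.congr_of_eventuallyEq ?_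
    filter_upwards [Icc_mem_nhds (a := 1-δ) (b := 1+δ) (x := (1:ℝ)) (by linarith) (by linarith)]
      with τ hτ
    exact V_eq f hf (hlt τ hτ)
  · intro τ hτ
    apply intervalIntegral.continuous_parametric_intervalIntegral_of_continuous
    · fun_prop
    · exact hLc.comp (f := fun ω : sphere (0:E) 1 => (τ, (ω:E))) (by fun_prop)
  · have h1 : Continuous (fun z : ℝ × sphere (0:E) 1 => Dl p z.1 (z.2:E)) :=
      hDc.comp (f := fun z : ℝ × sphere (0:E) 1 => (z.1, (z.2:E))) (by fun_prop)
    have h2 : Continuous (fun z : ℝ × sphere (0:E) 1 => Ll p z.1 (z.2:E)) :=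
      hLc.comp (f := fun z : ℝ × sphere (0:E) 1 => (z.1, (z.2:E))) (by fun_prop)
    refine ContinuousOn.mul (Continuous.continuousOn (by fun_prop)) ?_
    exact ContinuousOn.div (by fun_prop) h1.continuousOn
      (fun z hz => (Dl_pos (hlt z.1 hz.1) _).ne')
  · intro τ hτ ω
    have hD : HasDerivAt (fun τ => Dl p τ (ω:E)) (τ / Dl p τ (ω:E)) τ := by
      have h1 : HasDerivAt (fun τ : ℝ => τ^2 - ‖p‖^2 + ⟪p, (ω:E)⟫^2) (2*τ) τ := by
        have := ((hasDerivAt_pow 2 τ).sub_const (‖p‖^2)).add_const (⟪p, (ω:E)⟫^2)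
        simpa using this
      have h2 := h1.sqrt (Dl_arg_pos (hlt τ hτ) (ω:E)).ne'
      rw [mul_div_mul_left _ _ (two_ne_zero)] at h2
      exact h2
    have hL : HasDerivAt (fun τ => Ll p τ (ω:E)) (τ / Dl p τ (ω:E)) τ := hD.sub_const _
    have hcont : Continuous (fun r : ℝ => r^(finrank ℝ E - 1) * f (p + r • (ω : E))) := by
      fun_prop
    have h3 := (hcont.integral_hasStrictDerivAt 0 (Ll p τ (ω:E))).hasDerivAt
    have := h3.comp τ hL
    exact this

/-- cone change of variables -/
theorem cone (f : E → ℝ) (hf : Continuous f) {p : E} (h : ‖p‖ < 1) :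
    ∫ ω, f (ω:E) ∂(sg E) =
    (∫ ω, Ll p 1 (ω:E) ^ (finrank ℝ E - 1) * f (p + Ll p 1 (ω:E) • (ω:E)) * (1 / Dl p 1 (ω:E))
        ∂(sg E)) := by
  have h0 : ‖(0:E)‖ < 1 := by simp
  have := (V_deriv f hf h0).unique (V_deriv f hf h)
  rw [← this]
  simp [Ll, Dl]

theorem V_deriv0 (f : E → ℝ) (hf : Continuous f) :
    HasDerivAt (fun τ => ∫ x in ball (0:E) τ, f x) (∫ ω, f (ω:E) ∂(sg E)) 1 := by
  have h0 : ‖(0:E)‖ < 1 := by simp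
  rw [cone f hf h0]
  exact V_deriv f hf h0

theorem sphere_isom (f : E → ℝ) (hf : Continuous f) (R : E ≃ₗᵢ[ℝ] E) :
    ∫ ω, f (R (ω:E)) ∂(sg E) = ∫ ω, f (ω:E) ∂(sg E) := by
  have h1 := V_deriv0 f hf
  have h2 := V_deriv0 (fun x => f (R x)) (hf.comp R.continuous)
  refine h2.unique (h1.congr_of_eventuallyEq (Filter.Eventually.of_forall fun τ => ?_))
  simp only
  have := (R.measurePreserving).setIntegral_preimage_emb
    (R.toHomeomorph.measurableEmbedding) f (ball 0 τ)
  rw [← this]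
  congr 2
  ext x
  simp

theorem sphere_neg (f : E → ℝ) (hf : Continuous f) :
    ∫ ω, f (-(ω:E)) ∂(sg E) = ∫ ω, f (ω:E) ∂(sg E) := by
  simpa using sphere_isom f hf (LinearIsometryEquiv.neg ℝ)

theorem sphere_integrable (f : E → ℝ) (hf : Continuous f) :
    Integrable (fun ω : sphere (0:E) 1 => f ω) (sg E) :=
  (hf.comp continuous_subtype_val).integrable_of_hasCompactSupport (HasCompactSupport.of_compactSpace _)

end Cone
end Khav

namespace Khav
section OneD
open MeasureTheory Set Metric Module
open scoped RealInnerProductSpace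

theorem vol_slice (m : ℕ) (hm : 1 ≤ m) (c : ℝ) :
    (volume : Measure (Fin m → ℝ)).real {y | ∑ i, y i ^ 2 < c} =
      (volume : Measure (EuclideanSpace ℝ (Fin m))).real (ball 0 1) * (max c 0) ^ ((m:ℝ)/2) := by
  have hmp := EuclideanSpace.volume_preserving_symm_measurableEquiv_toLp (Fin m)
  have hset : MeasurableSet {y : Fin m → ℝ | ∑ i, y i ^ 2 < c} :=
    (isOpen_lt (by fun_prop) (by fun_prop)).measurableSet
  have h1 := hmp.measure_preimage hset.nullMeasurableSet
  rw [measureReal_def, ← h1, measureReal_def]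
  have h2 : (⇑(MeasurableEquiv.toLp 2 (Fin m → ℝ)).symm ⁻¹' {y : Fin m → ℝ | ∑ i, y i ^ 2 < c}) =
      {y : EuclideanSpace ℝ (Fin m) | ‖y‖^2 < c} := by
    ext y
    simp [EuclideanSpace.norm_sq_eq]
  rw [h2]
  rcases le_or_gt c 0 with hc | hc
  · have : {y : EuclideanSpace ℝ (Fin m) | ‖y‖^2 < c} = ∅ := by
      ext y
      simp
      exact hc.trans (sq_nonneg _)
    rw [this, max_eq_right hc, Real.zero_rpow]
    · simp
    · have : (1:ℝ) ≤ m := by exact_mod_cast hm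
      positivity
  · have : {y : EuclideanSpace ℝ (Fin m) | ‖y‖^2 < c} = ball 0 (√c) := by
      ext y
      simp [Real.lt_sqrt (norm_nonneg y)]
    rw [this, Measure.addHaar_ball_of_pos _ _ (Real.sqrt_pos.2 hc), max_eq_left hc.le,
      ENNReal.toReal_mul, ENNReal.toReal_ofReal (by positivity), mul_comm]
    congr 1
    rw [Real.sqrt_eq_rpow, ← Real.rpow_natCast, ← Real.rpow_mul hc.le]
    congr 1
    simp
    ring

theorem V_slice (m : ℕ) (hm : 1 ≤ m) (g : ℝ → ℝ) (hg : Continuous g) (τ : ℝ) (hτ : 0 < τ) :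
    ∫ z in ball (0 : EuclideanSpace ℝ (Fin (m+1))) τ, g (z 0) =
      (volume : Measure (EuclideanSpace ℝ (Fin m))).real (ball 0 1) *
        ∫ s, g s * (max (τ^2 - s^2) 0) ^ ((m:ℝ)/2) := by
  let Ψ := (MeasurableEquiv.toLp 2 (Fin (m+1) → ℝ)).symm.trans
    (MeasurableEquiv.piFinSuccAbove (fun _ => ℝ) 0)
  have hΨ : MeasurePreserving Ψ volume volume :=
    (EuclideanSpace.volume_preserving_symm_measurableEquiv_toLp (Fin (m+1))).trans
      (volume_preserving_piFinSuccAbove (fun _ => ℝ) 0)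
  let G : ℝ × (Fin m → ℝ) → ℝ := fun z => g z.1 * indicator {y | ∑ i, y i ^ 2 < τ^2 - z.1^2} 1 z.2
  have hGΨ : ∀ z : EuclideanSpace ℝ (Fin (m+1)), G (Ψ z) = indicator (ball 0 τ) (fun z => g (z 0)) z := by
    intro z
    have h1 : (Ψ z).1 = z 0 := rfl
    have h2 : ∀ i, (Ψ z).2 i = z i.succ := fun i => rfl
    simp only [G, h1, indicator, h2, mem_ofPred_eq, mem_ball_zero_iff]
    have h3 : (∑ i : Fin m, z i.succ ^2 < τ^2 - z 0 ^2) ↔ ‖z‖ < τ := by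
      rw [← sq_lt_sq₀ (norm_nonneg _) hτ.le, EuclideanSpace.norm_sq_eq, Fin.sum_univ_succ]
      simp only [Real.norm_eq_abs, sq_abs]
      rw [lt_sub_iff_add_lt, add_comm]
    simp only [h3]
    split_ifs <;> simp
  have hintegr : Integrable (indicator (ball 0 τ) (fun z : EuclideanSpace ℝ (Fin (m+1)) => g (z 0))) := by
    rw [integrable_indicator_iff measurableSet_ball]
    have : Continuous (fun z : EuclideanSpace ℝ (Fin (m+1)) => g (z 0)) := by fun_prop
    exact (this.continuousOn.integrableOn_compact (isCompact_closedBall _ τ)).mono_set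
      ball_subset_closedBall
  have hGint : Integrable G := by
    rw [← hΨ.integrable_comp_emb Ψ.measurableEmbedding]
    refine hintegr.congr (Filter.Eventually.of_forall fun z => (hGΨ z).symm)
  rw [← integral_indicator measurableSet_ball]
  simp_rw [← hGΨ]
  rw [hΨ.integral_comp' (g := G)]
  erw [integral_prod _ hGint]
  rw [← integral_const_mul]
  congr 1
  ext s
  simp only [G]
  rw [integral_const_mul, integral_indicator_one, vol_slice m hm]
  · ring
  · exact (isOpen_lt (by fun_prop) (by fun_prop)).measurableSet

theorem rpow_lip (p : ℝ) (hp : 1 ≤ p) (x y : ℝ) (hx : x ∈ Icc (0:ℝ) 4) (hy : y ∈ Icc (0:ℝ) 4) :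
    |x^p - y^p| ≤ p * 4^(p-1) * |x - y| := by
  have := Convex.norm_image_sub_le_of_norm_hasDerivWithin_le (f := fun x : ℝ => x^p)
    (f' := fun x => p * x^(p-1)) (s := Icc (0:ℝ) 4) (C := p * 4^(p-1)) (x := y) (y := x)
    (fun z hz => (Real.hasDerivAt_rpow_const (Or.inr hp)).hasDerivWithinAt)
    (fun z hz => by
      rw [Real.norm_eq_abs, abs_of_nonneg (mul_nonneg (by linarith) (Real.rpow_nonneg hz.1 _))]
      gcongr
      · exact hz.1
      · exact hz.2) (convex_Icc _ _) hy hx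
  simpa using this

theorem oneD_deriv (m : ℕ) (hm : 2 ≤ m) (g : ℝ → ℝ) (hg : Continuous g) :
    HasDerivAt (fun τ => ∫ s, g s * (max (τ^2 - s^2) 0) ^ ((m:ℝ)/2))
      (m * ∫ t in (-1:ℝ)..1, g t * (1-t^2)^(((m:ℝ)-2)/2)) 1 := by
  have hm' : (2:ℝ) ≤ m := by exact_mod_cast hm
  have hp : (1:ℝ) ≤ (m:ℝ)/2 := by linarith
  set p := (m:ℝ)/2 with hpdef
  let F' : ℝ → ℝ := fun s => indicator (Ioo (-1) 1) (fun s => g s * (m * (1-s^2)^(((m:ℝ)-2)/2))) s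
  obtain ⟨C, hC⟩ := (isCompact_Icc (a := (-2:ℝ)) (b := 2)).exists_bound_of_continuousOn hg.continuousOn
  have hC0 : 0 ≤ C := (norm_nonneg _).trans (hC 0 (by norm_num))
  have hFc : ∀ τ : ℝ, Continuous (fun s => g s * (max (τ^2 - s^2) 0) ^ p) := by
    intro τ
    refine hg.mul (Continuous.rpow_const (by fun_prop) (fun x => Or.inr (by linarith)))
  have key := hasDerivAt_integral_of_dominated_loc_of_lip
    (μ := volume.restrict (Icc (-2:ℝ) 2)) (x₀ := (1:ℝ)) (s := Ioo (0:ℝ) 2)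
    (F := fun τ s => g s * (max (τ^2 - s^2) 0) ^ p) (F' := F')
    (bound := fun _ => C * (p * 4^(p-1) * 4)) (Ioo_mem_nhds (by norm_num) (by norm_num))
    (Filter.Eventually.of_forall fun τ => (hFc τ).aestronglyMeasurable)
    ((hFc 1).continuousOn.integrableOn_compact isCompact_Icc) ?_ ?_ (integrable_const _) ?_
  · have h2 := key.2
    have e1 : ∫ s in Icc (-2:ℝ) 2, F' s = m * ∫ t in (-1:ℝ)..1, g t * (1-t^2)^(((m:ℝ)-2)/2) := by
      rw [intervalIntegral.integral_of_le (by norm_num), integral_Ioc_eq_integral_Ioo,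
        ← integral_const_mul]
      simp only [F']
      rw [setIntegral_indicator measurableSet_Ioo]
      have : Icc (-2:ℝ) 2 ∩ Ioo (-1) 1 = Ioo (-1) 1 :=
        inter_eq_right.2 (fun x hx => ⟨by linarith [hx.1], by linarith [hx.2]⟩)
      rw [this]
      congr 1
      ext s
      ring
    rw [e1] at h2
    refine h2.congr_of_eventuallyEq ?_
    filter_upwards [Ioo_mem_nhds (a := (0:ℝ)) (b := 2) (x := 1) (by norm_num) (by norm_num)] with τ hτ
    symm
    apply setIntegral_eq_integral_of_forall_compl_eq_zero
    intro s hs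
    have : τ^2 - s^2 ≤ 0 := by
      have h1 : ¬ |s| ≤ 2 := by
        intro h; exact hs (abs_le.1 h)
      push Not at h1
      have : τ^2 ≤ |s|^2 := by
        gcongr
        · exact hτ.1.le
        · linarith [hτ.2]
      rw [sq_abs] at this
      linarith
    rw [max_eq_right this, Real.zero_rpow (by linarith), mul_zero]
  · refine (Measurable.indicator ?_ measurableSet_Ioo).aestronglyMeasurable
    have := hg.measurable
    fun_prop
  · refine (ae_restrict_iff' measurableSet_Icc).2 (Filter.Eventually.of_forall fun s hs => ?_)
    refine LipschitzOnWith.of_dist_le_mul fun x hx y hy => ?_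
    have hb : ∀ z ∈ Ioo (0:ℝ) 2, max (z^2 - s^2) 0 ∈ Icc (0:ℝ) 4 := by
      intro z hz
      refine ⟨le_max_right _ _, max_le ?_ (by norm_num)⟩
      nlinarith [hz.1, hz.2, sq_nonneg s]
    have hL : |max (x^2 - s^2) 0 - max (y^2 - s^2) 0| ≤ 4 * |x - y| := by
      refine (abs_max_sub_max_le_abs _ _ _).trans ?_
      have : x^2 - s^2 - (y^2 - s^2) = (x+y)*(x-y) := by ring
      rw [this, abs_mul]
      gcongr
      rw [abs_of_nonneg (by linarith [hx.1, hy.1])]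
      linarith [hx.2, hy.2]
    have h4 : (0:ℝ) ≤ p * 4^(p-1) := by positivity
    rw [Real.dist_eq, Real.dist_eq, ← mul_sub, abs_mul]
    simp only [Real.coe_nnabs]
    rw [abs_of_nonneg (a := C * (p * 4^(p-1) * 4)) (by positivity)]
    calc |g s| * |max (x^2 - s^2) 0 ^ p - max (y^2 - s^2) 0 ^ p|
        ≤ C * (p * 4^(p-1) * (4 * |x-y|)) := by
          gcongr
          · exact hC s hs
          · exact (rpow_lip p hp _ _ (hb x hx) (hb y hy)).trans (by gcongr)
      _ = _ := by ring
  · have hne : ∀ᵐ s ∂(volume.restrict (Icc (-2:ℝ) 2)), s ≠ 1 ∧ s ≠ -1 := by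
      refine ae_restrict_of_ae ?_
      filter_upwards [Measure.ae_ne volume (1:ℝ), Measure.ae_ne volume (-1:ℝ)] with s h1 h2
      exact ⟨h1, h2⟩
    filter_upwards [hne] with s hs
    by_cases h1 : s ∈ Ioo (-1:ℝ) 1
    · have hpos : 0 < 1 - s^2 := by nlinarith [h1.1, h1.2]
      have hF's : F' s = g s * (2 * p * (1 ^ 2 - s^2)^(p-1)) := by
        simp only [F', indicator, h1, if_true]
        congr 2
        · rw [hpdef]; ring
        · congr 1
          · ring
          · rw [hpdef]; ring
      rw [hF's]
      have hd : HasDerivAt (fun τ : ℝ => τ^2 - s^2) 2 1 := by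
        simpa using (hasDerivAt_pow 2 (1:ℝ)).sub_const (s^2)
      have := (hd.rpow_const (p := p) (Or.inr hp)).const_mul (g s)
      refine this.congr_of_eventuallyEq ?_
      have hev : ∀ᶠ τ in nhds (1:ℝ), 0 < τ^2 - s^2 :=
        (hd.continuousAt.eventually_const_lt (by simpa using hpos))
      filter_upwards [hev] with τ hτ
      rw [max_eq_left hτ.le]
    · have hF's : F' s = 0 := by simp only [F', indicator, h1, if_false]
      rw [hF's]
      have hneg : 1 - s^2 < 0 := by
        have : ¬ |s| < 1 := fun h => h1 (abs_lt.1 h)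
        have h3 : |s| ≠ 1 := by
          intro h
          rcases eq_or_eq_neg_of_abs_eq h with h | h
          · exact hs.1 h
          · exact hs.2 h
        have h4 : 1 < |s| := lt_of_le_of_ne (not_lt.1 this) h3.symm
        have : 1 < |s|^2 := by nlinarith
        rw [sq_abs] at this
        linarith
      have hc : ContinuousAt (fun τ : ℝ => τ^2 - s^2) 1 := by fun_prop
      refine (hasDerivAt_const (1:ℝ) (0:ℝ)).congr_of_eventuallyEq ?_
      have hev : ∀ᶠ τ in nhds (1:ℝ), τ^2 - s^2 < 0 :=
        (hc.eventually_lt_const (by simpa using hneg))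
      filter_upwards [hev] with τ hτ
      rw [max_eq_right hτ.le, Real.zero_rpow (by linarith), mul_zero]

theorem oneD (m : ℕ) (hm : 2 ≤ m) (g : ℝ → ℝ) (hg : Continuous g)
    (e : EuclideanSpace ℝ (Fin (m+1))) (he : ‖e‖ = 1) :
    ∫ ω, g ⟪(ω : EuclideanSpace ℝ (Fin (m+1))), e⟫ ∂(sg (EuclideanSpace ℝ (Fin (m+1)))) =
      (volume : Measure (EuclideanSpace ℝ (Fin m))).real (ball 0 1) *
      (m * ∫ t in (-1:ℝ)..1, g t * (1-t^2)^(((m:ℝ)-2)/2)) := by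
  set e0 : EuclideanSpace ℝ (Fin (m+1)) := EuclideanSpace.single 0 1 with he0
  have hn : ‖e‖ = ‖e0‖ := by rw [he]; simp [he0]
  set R := Submodule.reflection (ℝ ∙ (e - e0))ᗮ with hR
  have hRe : R e = e0 := Submodule.reflection_sub hn
  have hRe0 : R e0 = e := by rw [← hRe, hR, Submodule.reflection_reflection]
  have h1 := sphere_isom (fun z => g ⟪z, e⟫) (by fun_prop) R
  rw [← h1]
  have h2 : ∀ z, ⟪R z, e⟫ = z 0 := by
    intro z
    rw [← hRe0, R.inner_map_map]
    simp [he0, EuclideanSpace.inner_single_right]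
  simp_rw [h2]
  refine (V_deriv0 (fun z : EuclideanSpace ℝ (Fin (m+1)) => g (z 0)) (by fun_prop)).unique ?_
  refine ((oneD_deriv m hm g hg).const_mul _).congr_of_eventuallyEq ?_
  filter_upwards [Ioi_mem_nhds (show (0:ℝ) < 1 by norm_num)] with τ hτ
  exact V_slice m (by omega) g hg τ hτ

end OneD
end Khav

namespace Khav
section Mono
open Real Set

noncomputable def Ef (lam κ ν s : ℝ) : ℝ := exp (-2*s) * (κ - ν * exp (2*s)) ^ (-lam)
noncomputable def yf (κ ν s : ℝ) : ℝ := ν * exp (2*s) / (κ - ν * exp (2*s))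

theorem yf_deriv (κ ν s : ℝ) (h : 0 < κ - ν * exp (2*s)) :
    HasDerivAt (yf κ ν) (2 * yf κ ν s * (1 + yf κ ν s)) s := by
  have h1 : HasDerivAt (fun s : ℝ => ν * exp (2*s)) (ν * (exp (2*s) * 2)) s := by
    have : HasDerivAt (fun s : ℝ => 2 * s) 2 s := by simpa using (hasDerivAt_id s).const_mul 2
    exact (this.exp).const_mul ν
  have h2 := h1.div (h1.const_sub κ) h.ne'
  refine h2.congr_deriv ?_
  unfold yf
  field_simp
  ring

theorem Ef_deriv (lam κ ν s : ℝ) (h : 0 < κ - ν * exp (2*s)) :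
    HasDerivAt (Ef lam κ ν) (2 * Ef lam κ ν s * (lam * yf κ ν s - 1)) s := by
  have h1 : HasDerivAt (fun s : ℝ => ν * exp (2*s)) (ν * (exp (2*s) * 2)) s := by
    have : HasDerivAt (fun s : ℝ => 2 * s) 2 s := by simpa using (hasDerivAt_id s).const_mul 2
    exact (this.exp).const_mul ν
  have h3 : HasDerivAt (fun s : ℝ => exp (-2*s)) (exp (-2*s) * (-2)) s := by
    have : HasDerivAt (fun s : ℝ => -2 * s) (-2) s := by simpa using (hasDerivAt_id s).const_mul (-2)
    exact this.exp
  have h2 := (h1.const_sub κ).rpow_const (p := -lam) (Or.inl h.ne')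
  refine (h3.mul h2).congr_deriv ?_
  rw [rpow_sub_one h.ne']
  unfold yf Ef
  field_simp
  ring

theorem Ef_pos (lam κ ν s : ℝ) (h : 0 < κ - ν * exp (2*s)) : 0 < Ef lam κ ν s :=
  mul_pos (exp_pos _) (rpow_pos_of_pos h _)

noncomputable def D1f (lam κ ν s : ℝ) : ℝ := 2 * Ef lam κ ν s * (lam * yf κ ν s - 1)

theorem D1f_deriv (lam κ ν s : ℝ) (h : 0 < κ - ν * exp (2*s)) :
    HasDerivAt (D1f lam κ ν)
      (Ef lam κ ν s * (4*lam*(lam+1)*(yf κ ν s)^2 - 4 * lam * yf κ ν s + 4)) s := by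
  have h1 := ((Ef_deriv lam κ ν s h).const_mul 2).mul
    (((yf_deriv κ ν s h).const_mul lam).sub_const 1)
  refine h1.congr_deriv ?_
  ring

theorem N_mono (lam κ ν S : ℝ) (hl : 0 < lam) (hν : 0 ≤ ν) (h : 0 < κ - ν * exp (2*S)) :
    MonotoneOn (fun s => (Ef lam κ ν s + Ef lam κ ν (-s)) / cosh s) (Icc 0 S) := by
  have hpos : ∀ s, s ≤ S → 0 < κ - ν * exp (2*s) := by
    intro s hs
    have : ν * exp (2*s) ≤ ν * exp (2*S) := by gcongr
    linarith
  have hneg : ∀ s ∈ Icc 0 S, -s ≤ S := fun s hs => by linarith [hs.1, hs.2]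
  have dN : ∀ s ∈ Icc 0 S, HasDerivAt (fun s => Ef lam κ ν s + Ef lam κ ν (-s))
      (D1f lam κ ν s - D1f lam κ ν (-s)) s := by
    intro s hs
    have h2 := HasDerivAt.scomp s (Ef_deriv lam κ ν (-s) (hpos _ (hneg s hs))) (hasDerivAt_neg s)
    refine ((Ef_deriv lam κ ν s (hpos s hs.2)).add h2).congr_deriv ?_
    simp [D1f]
    ring
  let D2 : ℝ → ℝ := fun s =>
    (Ef lam κ ν s * (4*lam*(lam+1)*(yf κ ν s)^2 - 4 * lam * yf κ ν s + 4))
  have dN1 : ∀ s ∈ Icc 0 S, HasDerivAt (fun s => D1f lam κ ν s - D1f lam κ ν (-s))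
      (D2 s + D2 (-s)) s := by
    intro s hs
    have h2 := HasDerivAt.scomp s (D1f_deriv lam κ ν (-s) (hpos _ (hneg s hs))) (hasDerivAt_neg s)
    refine ((D1f_deriv lam κ ν s (hpos s hs.2)).sub h2).congr_deriv ?_
    simp [D2]
  have hD2 : ∀ s, s ≤ S → Ef lam κ ν s ≤ D2 s := by
    intro s hs
    have hE := Ef_pos lam κ ν s (hpos s hs)
    have : 1 ≤ 4*lam*(lam+1)*(yf κ ν s)^2 - 4 * lam * yf κ ν s + 4 := by
      nlinarith [sq_nonneg (2 * lam * yf κ ν s - 1), mul_nonneg hl.le (sq_nonneg (yf κ ν s))]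
    calc Ef lam κ ν s = Ef lam κ ν s * 1 := by ring
      _ ≤ _ := by simp only [D2]; gcongr
  let W : ℝ → ℝ := fun s => (D1f lam κ ν s - D1f lam κ ν (-s)) * cosh s -
    (Ef lam κ ν s + Ef lam κ ν (-s)) * sinh s
  have dW : ∀ s ∈ Icc 0 S, HasDerivAt W
      ((D2 s + D2 (-s) - (Ef lam κ ν s + Ef lam κ ν (-s))) * cosh s) s := by
    intro s hs
    refine (((dN1 s hs).mul (hasDerivAt_cosh s)).sub ((dN s hs).mul (hasDerivAt_sinh s))).congr_deriv ?_
    ring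
  have hW : MonotoneOn W (Icc 0 S) := by
    refine monotoneOn_of_hasDerivWithinAt_nonneg (convex_Icc 0 S)
      (fun s hs => (dW s hs).continuousAt.continuousWithinAt)
      (fun s hs => (dW s (interior_subset hs)).hasDerivWithinAt) (fun s hs => ?_)
    have hs' := interior_subset hs
    refine mul_nonneg ?_ (cosh_pos s).le
    linarith [hD2 s hs'.2, hD2 (-s) (hneg s hs')]
  have hW0 : ∀ s ∈ Icc 0 S, 0 ≤ W s := by
    intro s hs
    have := hW ⟨le_refl 0, hs.1.trans hs.2⟩ hs hs.1
    simpa [W] using this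
  refine monotoneOn_of_hasDerivWithinAt_nonneg (convex_Icc 0 S) (f' := fun s => W s / cosh s ^ 2)
    (fun s hs => ((dN s hs).div (hasDerivAt_cosh s) (cosh_pos s).ne').continuousAt.continuousWithinAt)
    (fun s hs => ((dN s (interior_subset hs)).div (hasDerivAt_cosh s)
      (cosh_pos s).ne').hasDerivWithinAt) (fun s hs => ?_)
  exact div_nonneg (hW0 s (interior_subset hs)) (by positivity)

/-- the functions of the latitude `c` -/
noncomputable def dlc (a c : ℝ) : ℝ := √(1 - a^2 + (a*c)^2)
noncomputable def llc (a c : ℝ) : ℝ := dlc a c - a*c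
noncomputable def qc (ρ a c : ℝ) : ℝ := 1 + ρ^2 - 2*ρ*(a + c * llc a c)
noncomputable def kc (n : ℕ) (lam ρ a c : ℝ) : ℝ := llc a c ^ n / dlc a c * qc ρ a c ^ (-lam)

theorem dlc_arg_pos {a : ℝ} (h0 : 0 ≤ a) (h1 : a < 1) (c : ℝ) : 0 < 1 - a^2 + (a*c)^2 := by
  nlinarith [sq_nonneg (a*c)]

theorem dlc_sq {a : ℝ} (h0 : 0 ≤ a) (h1 : a < 1) (c : ℝ) : dlc a c ^2 = 1 - a^2 + (a*c)^2 :=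
  sq_sqrt (dlc_arg_pos h0 h1 c).le

theorem dlc_pos {a : ℝ} (h0 : 0 ≤ a) (h1 : a < 1) (c : ℝ) : 0 < dlc a c :=
  sqrt_pos.2 (dlc_arg_pos h0 h1 c)

theorem llc_pos {a : ℝ} (h0 : 0 ≤ a) (h1 : a < 1) (c : ℝ) : 0 < llc a c := by
  have h2 := dlc_sq h0 h1 c
  have h3 := dlc_pos h0 h1 c
  have : a*c < dlc a c := by
    by_contra hc
    push Not at hc
    nlinarith
  unfold llc; linarith

theorem tc_le {a : ℝ} (h0 : 0 ≤ a) (h1 : a < 1) {c : ℝ} (hc : |c| ≤ 1) :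
    a + c * llc a c ≤ 1 := by
  have h2 := dlc_sq h0 h1 c
  have h3 : 1 - (a + c * llc a c)^2 = llc a c ^2 * (1 - c^2) := by
    unfold llc
    linear_combination (-1:ℝ) * h2
  have h4 : c^2 ≤ 1 := (sq_le_one_iff_abs_le_one c).2 hc
  have h5 : (a + c * llc a c)^2 ≤ 1 := by nlinarith [sq_nonneg (llc a c)]
  exact (abs_le.1 ((sq_le_one_iff_abs_le_one _).1 h5)).2

theorem qc_pos {ρ a : ℝ} (hρ0 : 0 ≤ ρ) (hρ1 : ρ < 1) (h0 : 0 ≤ a) (h1 : a < 1) {c : ℝ}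
    (hc : |c| ≤ 1) : (1-ρ)^2 ≤ qc ρ a c := by
  have := tc_le h0 h1 hc
  unfold qc
  nlinarith

theorem kc_eq (n : ℕ) (lam ρ a : ℝ) (hn : (n:ℝ) = 2*lam+2) (hρ0 : 0 < ρ) (hρ1 : ρ < 1)
    (h0 : 0 < a) (h1 : a < 1) (c : ℝ) (hc : |c| ≤ 1) :
    let κ := ρ/a
    let ν := (ρ - a)*(1-a*ρ)/(a*(1-a^2))
    let s := arsinh (a*c/√(1-a^2))
    0 < κ - ν * exp (2*s) ∧ kc n lam ρ a c = √(1-a^2) * (Ef lam κ ν s / cosh s) := by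
  intro κ ν s
  have hA : 0 < 1 - a^2 := by nlinarith
  have hsA : 0 < √(1-a^2) := sqrt_pos.2 hA
  have hsA2 : √(1-a^2)^2 = 1 - a^2 := sq_sqrt hA.le
  have hd := dlc_sq h0.le h1 c
  have hdp := dlc_pos h0.le h1 c
  have hlp := llc_pos h0.le h1 c
  have hq := qc_pos hρ0.le hρ1 h0.le h1 hc
  have hqp : 0 < qc ρ a c := lt_of_lt_of_le (by nlinarith) hq
  have hcosh : cosh s = dlc a c / √(1-a^2) := by
    rw [cosh_arsinh, div_pow, hsA2, eq_div_iff hsA.ne', ← sqrt_mul (by positivity), dlc]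
    congr 1
    field_simp
  have hsinh : sinh s = a*c/√(1-a^2) := sinh_arsinh _
  have hexpn : exp (-s) = llc a c / √(1-a^2) := by
    rw [← cosh_sub_sinh, hcosh, hsinh, llc]; ring
  have hexpn2 : exp (-2*s) = llc a c ^2 / (1-a^2) := by
    have : exp (-2*s) = exp (-s) ^ 2 := by rw [← exp_nat_mul]; congr 1; push_cast; ring
    rw [this, hexpn, div_pow, hsA2]
  have hexp2 : exp (2*s) = (1-a^2) / llc a c ^2 := by
    have : exp (2*s) = (exp (-2*s))⁻¹ := by rw [← exp_neg]; congr 1; ring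
    rw [this, hexpn2, inv_div]
  have hqe : qc ρ a c = llc a c ^ 2 * (κ - ν * exp (2*s)) := by
    rw [hexp2]
    simp only [κ, ν]
    have hAL : 1 - a^2 - llc a c ^2 = 2*a*c*llc a c := by
      unfold llc
      linear_combination (-1:ℝ) * hd
    unfold qc
    have hA' := hA.ne'
    field_simp
    linear_combination (ρ) * hAL
  have hE : 0 < κ - ν * exp (2*s) := by
    rw [hqe] at hqp
    exact (mul_pos_iff_of_pos_left (by positivity)).1 hqp
  refine ⟨hE, ?_⟩
  rw [kc, hqe, mul_rpow (by positivity) hE.le, Ef, hexpn2, hcosh]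
  have hLn : llc a c ^ n * (llc a c ^ 2) ^ (-lam) = llc a c ^ 2 := by
    rw [← rpow_natCast, ← rpow_natCast, ← rpow_mul hlp.le, ← rpow_add hlp, hn]
    congr 1
    push_cast; ring
  calc llc a c ^ n / dlc a c * ((llc a c ^ 2) ^ (-lam) * (κ - ν * exp (2 * s)) ^ (-lam))
      = (llc a c ^ n * (llc a c ^ 2) ^ (-lam)) / dlc a c * (κ - ν * exp (2 * s)) ^ (-lam) := by ring
    _ = llc a c ^ 2 / dlc a c * (κ - ν * exp (2 * s)) ^ (-lam) := by rw [hLn]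
    _ = _ := by
      have hA' := hA.ne'
      generalize (κ - ν * exp (2 * s)) ^ (-lam) = X
      field_simp
      rw [hsA2]

theorem kc_mono (n : ℕ) (lam ρ a : ℝ) (hlam : 0 < lam) (hn : (n:ℝ) = 2*lam+2) (hρ0 : 0 ≤ ρ)
    (hρ1 : ρ < 1) (ha : a = lam*ρ/(lam+1)) (c d : ℝ) (hc : 0 ≤ c) (hcd : c ≤ d) (hd : d ≤ 1) :
    kc n lam ρ a c + kc n lam ρ a (-c) ≤ kc n lam ρ a d + kc n lam ρ a (-d) := by
  rcases hρ0.eq_or_lt with rfl | hρ0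
  · have : a = 0 := by rw [ha]; simp
    subst this
    simp [kc, llc, dlc, qc]
  have ha0 : 0 < a := by rw [ha]; positivity
  have haρ : a ≤ ρ := by
    rw [ha, div_le_iff₀ (by positivity)]; nlinarith
  have ha1 : a < 1 := by linarith
  have hA : 0 < 1 - a^2 := by nlinarith
  have hsA : 0 < √(1-a^2) := sqrt_pos.2 hA
  have hν : 0 ≤ (ρ - a)*(1-a*ρ)/(a*(1-a^2)) := by
    have : 0 ≤ 1 - a*ρ := by nlinarith
    have : 0 ≤ ρ - a := by linarith
    positivity
  have A1 := kc_eq n lam ρ a hn hρ0 hρ1 ha0 ha1 c (by rw [abs_of_nonneg hc]; linarith)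
  have A2 := kc_eq n lam ρ a hn hρ0 hρ1 ha0 ha1 (-c) (by rw [abs_neg, abs_of_nonneg hc]; linarith)
  have A3 := kc_eq n lam ρ a hn hρ0 hρ1 ha0 ha1 d (by rw [abs_of_nonneg (hc.trans hcd)]; linarith)
  have A4 := kc_eq n lam ρ a hn hρ0 hρ1 ha0 ha1 (-d) (by rw [abs_neg, abs_of_nonneg (hc.trans hcd)]; linarith)
  simp only at A1 A2 A3 A4
  rw [A1.2, A2.2, A3.2, A4.2]
  have hs : ∀ c, arsinh (a * (-c) / √(1-a^2)) = - arsinh (a * c / √(1-a^2)) := by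
    intro c
    rw [← arsinh_neg]; congr 1; ring
  rw [hs, hs, cosh_neg, cosh_neg, ← mul_add, ← mul_add, ← add_div, ← add_div]
  have hm := N_mono lam (ρ/a) ((ρ - a)*(1-a*ρ)/(a*(1-a^2))) _ hlam hν A3.1
  have h0c : 0 ≤ arsinh (a * c / √(1-a^2)) := arsinh_nonneg_iff.2 (by positivity)
  have hcd' : arsinh (a * c / √(1-a^2)) ≤ arsinh (a * d / √(1-a^2)) := arsinh_le_arsinh.2 (by gcongr)
  have := hm ⟨h0c, hcd'⟩ ⟨h0c.trans hcd', le_refl _⟩ hcd'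
  simp only at this
  gcongr

end Mono
end Khav

namespace Khav
section Kern
open MeasureTheory Set Metric Module
open scoped RealInnerProductSpace
variable {E : Type*} [NormedAddCommGroup E] [InnerProductSpace ℝ E]

/-- truncated directional derivative of the Poisson kernel -/
noncomputable def dPt (n : ℕ) (x l ζ : E) : ℝ :=
  -2 * ⟪x, l⟫ / (max ‖x - ζ‖ (1 - ‖x‖)) ^ n
    - n * (1 - ‖x‖^2) * ⟪x - ζ, l⟫ / (max ‖x - ζ‖ (1 - ‖x‖)) ^ (n+2)

noncomputable def Qt (x ζ : E) : ℝ := max (1 + ‖x‖^2 - 2 * ⟪ζ, x⟫) ((1 - ‖x‖)^2)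

theorem Qt_pos {x : E} (hx : ‖x‖ < 1) (ζ : E) : 0 < Qt x ζ :=
  lt_of_lt_of_le (by nlinarith) (le_max_right _ _)

noncomputable def Ft (n : ℕ) (lam : ℝ) (x l ζ : E) : ℝ :=
  n / (1 - ‖x‖^2) * (|⟪ζ - (lam/(lam+1)) • x, l⟫| * Qt x ζ ^ (-lam))

theorem dPt_cont (n : ℕ) {x : E} (hx : ‖x‖ < 1) (l : E) : Continuous (dPt n x l) := by
  have h : ∀ ζ, max ‖x - ζ‖ (1 - ‖x‖) ≠ 0 := fun ζ =>
    (lt_of_lt_of_le (by linarith) (le_max_right _ _)).ne'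
  unfold dPt
  refine Continuous.sub (Continuous.div (by fun_prop) (by fun_prop) ?_)
    (Continuous.div (by fun_prop) (by fun_prop) ?_)
  · exact fun ζ => pow_ne_zero _ (h ζ)
  · exact fun ζ => pow_ne_zero _ (h ζ)

theorem Qt_rpow_cont {x : E} (hx : ‖x‖ < 1) (p : ℝ) : Continuous (fun ζ => Qt x ζ ^ p) := by
  have : Continuous (Qt x) := by unfold Qt; fun_prop
  exact this.rpow_const (fun ζ => Or.inl (Qt_pos hx ζ).ne')

theorem Ft_cont (n : ℕ) (lam : ℝ) {x : E} (hx : ‖x‖ < 1) (l : E) : Continuous (Ft n lam x l) := by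
  have := Qt_rpow_cont hx (-lam)
  unfold Ft
  fun_prop

theorem Dl_cont (p : E) (τ : ℝ) : Continuous (Dl p τ) := by unfold Dl; fun_prop
theorem Ll_cont (p : E) (τ : ℝ) : Continuous (Ll p τ) := by
  have := Dl_cont p τ
  unfold Ll; fun_prop

theorem Qt_ray {x : E} (hx : ‖x‖ < 1) (ω : E) (hω : ‖ω‖ = 1) :
    Qt x (x + Ll x 1 ω • ω) = Ll x 1 ω ^ 2 := by
  have h1 := norm_ray hx ω hω
  have h2 : ‖Ll x 1 ω • ω‖ = Ll x 1 ω := by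
    rw [norm_smul, hω, mul_one, Real.norm_eq_abs, abs_of_pos (Ll_pos hx ω)]
  have h3 : 1 + ‖x‖^2 - 2 * ⟪x + Ll x 1 ω • ω, x⟫ = Ll x 1 ω ^ 2 := by
    have := norm_sub_sq_real (x + Ll x 1 ω • ω) x
    rw [add_sub_cancel_left, h2, h1] at this
    linarith
  have h4 : 1 - ‖x‖ ≤ Ll x 1 ω := by
    have := norm_add_le x (Ll x 1 ω • ω)
    rw [h1, h2] at this
    linarith
  rw [Qt, h3, max_eq_left]
  have : 0 ≤ 1 - ‖x‖ := by linarith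
  gcongr

variable [FiniteDimensional ℝ E] [MeasurableSpace E] [BorelSpace E] [Nontrivial E]

theorem kern_a (lam : ℝ) (hlam : 0 < lam) (hn : (finrank ℝ E : ℝ) = 2*lam+2) {x : E} (hx : ‖x‖ < 1)
    (l : E) : ∫ ω, |dPt (finrank ℝ E) x l (ω:E)| ∂(sg E) = ∫ ω, Ft (finrank ℝ E) lam x l (ω:E) ∂(sg E) := by
  set n := finrank ℝ E with hndef
  have hn1 : 1 ≤ n := Module.finrank_pos
  obtain ⟨m, hm⟩ : ∃ m, n = m + 1 := ⟨n-1, by omega⟩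
  have hD := Dl_cont x 1
  have hL := Ll_cont x 1
  have hdc := dPt_cont n hx l
  rw [cone (fun ζ => |dPt n x l ζ|) (by fun_prop) hx, cone (Ft n lam x l) (Ft_cont n lam hx l) hx]
  rw [← hndef]
  have hcont : Continuous (fun ω : E => Ll x 1 ω ^ (n-1) * |dPt n x l (x + Ll x 1 ω • ω)| * (1 / Dl x 1 ω)) := by
    refine Continuous.mul (by fun_prop) ?_
    exact continuous_const.div hD (fun ω => (Dl_pos hx ω).ne')
  rw [← sphere_neg _ hcont]
  congr 1
  ext ω'
  obtain ⟨ω, hω'⟩ := ω'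
  have hω : ‖ω‖ = 1 := by simpa using hω'
  simp only
  rw [Dl_neg]
  congr 1
  have hLp := Ll_pos hx ω
  have hLp' := Ll_pos hx (-ω)
  have hLL := Ll_mul_neg hx ω
  have hρ : 0 < 1 - ‖x‖^2 := by nlinarith [norm_nonneg x]
  have hmax : max ‖x - (x + Ll x 1 (-ω) • -ω)‖ (1 - ‖x‖) = Ll x 1 (-ω) := by
    have h1 := norm_ray hx (-ω) (by rwa [norm_neg])
    have h2 : ‖Ll x 1 (-ω) • (-ω)‖ = Ll x 1 (-ω) := by
      rw [norm_smul, norm_neg, hω, mul_one, Real.norm_eq_abs, abs_of_pos hLp']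
    have := norm_add_le x (Ll x 1 (-ω) • -ω)
    rw [h1, h2] at this
    rw [sub_add_cancel_left, norm_neg, h2, max_eq_left (by linarith)]
  rw [dPt, hmax, Ft, Qt_ray hx ω hω]
  have hin : ⟪x - (x + Ll x 1 (-ω) • -ω), l⟫ = Ll x 1 (-ω) * ⟪ω, l⟫ := by
    rw [sub_add_cancel_left, smul_neg, neg_neg, inner_smul_left]; simp
  have hin2 : ⟪x + Ll x 1 ω • ω - (lam / (lam + 1)) • x, l⟫ = 2/(n:ℝ) * ⟪x, l⟫ + Ll x 1 ω * ⟪ω, l⟫ := by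
    rw [inner_sub_left, inner_add_left, inner_smul_left, inner_smul_left]
    simp only [conj_trivial]
    rw [hn]
    field_simp
    ring
  rw [hin, hin2]
  set L := Ll x 1 ω
  set L' := Ll x 1 (-ω)
  have hnpos : (0:ℝ) < n := by rw [hn]; positivity
  have hpow : L ^ (n-1) * (L^2)^(-lam) = L := by
    have h1 : ((n-1 : ℕ) : ℝ) = 2*lam+1 := by
      rw [Nat.cast_sub hn1, hn]; push_cast; ring
    rw [← Real.rpow_natCast L (n-1), ← Real.rpow_natCast L 2, ← Real.rpow_mul hLp.le, ← Real.rpow_add hLp, h1]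
    have : 2 * lam + 1 + ((2:ℕ):ℝ) * -lam = 1 := by push_cast; ring
    rw [this, Real.rpow_one]
  have hL' : (1 - ‖x‖^2) = L * L' := by rw [hLL]; ring
  have e1 : L' ^ (n-1) * |-2 * ⟪x, l⟫ / L' ^ n - n * (1 - ‖x‖^2) * (L' * ⟪ω, l⟫) / L' ^ (n+2)| =
      |2 * ⟪x, l⟫ + n * L * ⟪ω, l⟫| / L' := by
    rw [hL', ← abs_of_pos (pow_pos hLp' (n-1)), ← abs_mul]
    have : |2 * ⟪x, l⟫ + n * L * ⟪ω, l⟫| / L' = |(2 * ⟪x, l⟫ + n * L * ⟪ω, l⟫) / L'| := by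
      rw [abs_div, abs_of_pos hLp']
    rw [this, ← abs_neg]
    congr 1
    rw [hm, Nat.add_sub_cancel]
    field_simp
    ring
  rw [e1]
  have e2 : L ^ (n-1) * (n / (1 - ‖x‖^2) * (|2/(n:ℝ) * ⟪x, l⟫ + L * ⟪ω, l⟫| * (L^2)^(-lam))) =
      (L ^ (n-1) * (L^2)^(-lam)) * (n / (1 - ‖x‖^2) * (|2/(n:ℝ) * ⟪x, l⟫ + L * ⟪ω, l⟫|)) := by ring
  rw [e2, hpow, hL']
  have e3 : |2 * ⟪x, l⟫ + n * L * ⟪ω, l⟫| = n * |2/(n:ℝ) * ⟪x, l⟫ + L * ⟪ω, l⟫| := by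
    rw [← abs_of_pos hnpos, ← abs_mul, abs_of_pos hnpos]
    congr 1
    field_simp
  rw [e3]
  field_simp

noncomputable def kt (n : ℕ) (lam ρ a c : ℝ) : ℝ :=
  llc a c ^ n / dlc a c * (max (qc ρ a c) ((1-ρ)^2)) ^ (-lam)

theorem kt_cont (n : ℕ) (lam : ℝ) {ρ a : ℝ} (hρ : ρ < 1) (h0 : 0 ≤ a) (h1 : a < 1) :
    Continuous (kt n lam ρ a) := by
  have hd : Continuous (dlc a) := by unfold dlc; fun_prop
  have hl : Continuous (llc a) := by unfold llc; fun_prop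
  have hq : Continuous (qc ρ a) := by unfold qc; fun_prop
  unfold kt
  refine ((hl.pow n).div hd (fun c => (dlc_pos h0 h1 c).ne')).mul ?_
  refine Continuous.rpow_const (by fun_prop) (fun c => Or.inl ?_)
  exact (lt_of_lt_of_le (by nlinarith : 0 < (1-ρ)^2) (le_max_right _ _)).ne'

theorem kt_eq (n : ℕ) (lam : ℝ) {ρ a : ℝ} (hρ0 : 0 ≤ ρ) (hρ : ρ < 1) (h0 : 0 ≤ a) (h1 : a < 1)
    {c : ℝ} (hc : |c| ≤ 1) : kt n lam ρ a c = kc n lam ρ a c := by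
  rw [kt, kc, max_eq_left (qc_pos hρ0 hρ h0 h1 hc)]

theorem kern_b (lam : ℝ) (hlam : 0 < lam) {x e : E} (hx : ‖x‖ < 1)
    (he : ‖e‖ = 1) (hxe : x = ‖x‖ • e) (l : E) :
    ∫ ω, Ft (finrank ℝ E) lam x l (ω:E) ∂(sg E) =
      finrank ℝ E / (1 - ‖x‖^2) *
        ∫ ω, |⟪(ω:E), l⟫| * kt (finrank ℝ E) lam ‖x‖ (lam*‖x‖/(lam+1)) ⟪(ω:E), e⟫ ∂(sg E) := by
  set n := finrank ℝ E with hndef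
  have hn1 : 1 ≤ n := Module.finrank_pos
  obtain ⟨m, hm⟩ : ∃ m, n = m + 1 := ⟨n-1, by omega⟩
  set ρ := ‖x‖ with hρ
  set a := lam*ρ/(lam+1) with ha
  have hρ0 : 0 ≤ ρ := norm_nonneg x
  have ha0 : 0 ≤ a := by positivity
  have haρ : a ≤ ρ := by
    rw [ha, div_le_iff₀ (by positivity)]; nlinarith
  have ha1 : a < 1 := by linarith
  set p : E := (lam/(lam+1)) • x with hp
  have hpe : p = a • e := by rw [hp, hxe, smul_smul]; congr 1; rw [ha]; ring
  have hpn : ‖p‖ = a := by rw [hpe, norm_smul, he, mul_one, Real.norm_eq_abs, abs_of_nonneg ha0]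
  have hp1 : ‖p‖ < 1 := by rw [hpn]; exact ha1
  rw [cone (Ft n lam x l) (Ft_cont n lam hx l) hp1, ← integral_const_mul]
  congr 1
  ext ω'
  obtain ⟨ω, hω'⟩ := ω'
  have hω : ‖ω‖ = 1 := by simpa using hω'
  simp only
  have hpω : ⟪p, ω⟫ = a * ⟪ω, e⟫ := by
    rw [hpe, inner_smul_left, real_inner_comm]; simp
  have hDl : Dl p 1 ω = dlc a ⟪ω, e⟫ := by
    rw [Dl, dlc, hpn, hpω]; norm_num
  have hLl : Ll p 1 ω = llc a ⟪ω, e⟫ := by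
    rw [Ll, llc, hDl, hpω]
  have hQ : Qt x (p + Ll p 1 ω • ω) = max (qc ρ a ⟪ω, e⟫) ((1-ρ)^2) := by
    rw [Qt, qc, ← hρ]
    congr 2
    have hx' : ⟪p + Ll p 1 ω • ω, x⟫ = ρ * ⟪p + Ll p 1 ω • ω, e⟫ := by
      conv_lhs => rw [hxe]
      rw [inner_smul_right]
    have hpe' : ⟪p, e⟫ = a := by
      rw [hpe, inner_smul_left, real_inner_self_eq_norm_sq, he]; simp
    rw [hx', inner_add_left, hpe', inner_smul_left, hLl]
    simp only [conj_trivial]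
    ring
  rw [Ft, hQ, ← hndef, ← hp, add_sub_cancel_left, inner_smul_left]
  simp only [conj_trivial]
  rw [abs_mul, abs_of_pos (Ll_pos hp1 ω), hLl, hDl, kt, ← hρ, hm, Nat.add_sub_cancel]
  ring

theorem kern_c (n : ℕ) (lam : ℝ) (hlam : 0 < lam) (hn : (n:ℝ) = 2*lam+2) {ρ a : ℝ} (hρ0 : 0 ≤ ρ)
    (hρ1 : ρ < 1) (ha : a = lam*ρ/(lam+1)) {e l : E} (he : ‖e‖ = 1) (hl : ‖l‖ = 1) :
    ∫ ω, |⟪(ω:E), l⟫| * kt n lam ρ a ⟪(ω:E), e⟫ ∂(sg E) ≤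
      ∫ ω, |⟪(ω:E), e⟫| * kt n lam ρ a ⟪(ω:E), e⟫ ∂(sg E) := by
  have ha0 : 0 ≤ a := by rw [ha]; positivity
  have haρ : a ≤ ρ := by
    rw [ha, div_le_iff₀ (by positivity)]; nlinarith
  have ha1 : a < 1 := by linarith
  have hk := kt_cont n lam hρ1 ha0 ha1
  let K : ℝ → ℝ := fun c => kt n lam ρ a c + kt n lam ρ a (-c)
  have hK : Continuous K := by simp only [K]; fun_prop
  have hKeven : ∀ c, K (-c) = K c := fun c => by simp [K, add_comm]
  have hKabs : ∀ c, K |c| = K c := fun c => by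
    rcases abs_choice c with h | h <;> rw [h]
    exact hKeven c
  have hKmono : ∀ c d, |c| ≤ |d| → |d| ≤ 1 → K c ≤ K d := by
    intro c d h1 h2
    rw [← hKabs c, ← hKabs d]
    simp only [K]
    rw [kt_eq, kt_eq, kt_eq, kt_eq]
    · exact kc_mono n lam ρ a hlam hn hρ0 hρ1 ha _ _ (abs_nonneg c) h1 h2
    all_goals first | assumption | skip
    all_goals simp
    all_goals linarith
  have hsym : ∀ v : E, 2 * ∫ ω, |⟪(ω:E), v⟫| * kt n lam ρ a ⟪(ω:E), e⟫ ∂(sg E) =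
      ∫ ω, |⟪(ω:E), v⟫| * K ⟪(ω:E), e⟫ ∂(sg E) := by
    intro v
    have h1 := sphere_neg (fun ω : E => |⟪ω, v⟫| * kt n lam ρ a ⟪ω, e⟫) (by fun_prop)
    simp only [inner_neg_left, abs_neg] at h1
    have h2 : ∀ ω : sphere (0:E) 1, |⟪(ω:E), v⟫| * K ⟪(ω:E), e⟫ =
      |⟪(ω:E), v⟫| * kt n lam ρ a ⟪(ω:E), e⟫ + |⟪(ω:E), v⟫| * kt n lam ρ a (-⟪(ω:E), e⟫) :=
      fun ω => by simp only [K]; ring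
    simp_rw [h2]
    rw [integral_add, h1]
    · ring
    · exact sphere_integrable (fun ω : E => |⟪ω, v⟫| * kt n lam ρ a ⟪ω, e⟫) (by fun_prop)
    · exact sphere_integrable (fun ω : E => |⟪ω, v⟫| * kt n lam ρ a (-⟪ω, e⟫)) (by fun_prop)
  set R := Submodule.reflection (ℝ ∙ (e - l))ᗮ with hR
  have hRe : R e = l := Submodule.reflection_sub (by rw [he, hl])
  have hRl : R l = e := by rw [← hRe, hR, Submodule.reflection_reflection]
  have hRe' : ∀ z, ⟪R z, e⟫ = ⟪z, l⟫ := fun z => by rw [← hRl, R.inner_map_map]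
  have hRl' : ∀ z, ⟪R z, l⟫ = ⟪z, e⟫ := fun z => by rw [← hRe, R.inner_map_map]
  have s1 := sphere_isom (fun ω : E => |⟪ω, l⟫| * K ⟪ω, e⟫) (by fun_prop) R
  have s2 := sphere_isom (fun ω : E => |⟪ω, e⟫| * K ⟪ω, e⟫) (by fun_prop) R
  simp only [hRe', hRl'] at s1 s2
  have hI : ∀ v w : E, Integrable (fun ω : sphere (0:E) 1 => |⟪(ω:E), v⟫| * K ⟪(ω:E), w⟫) (sg E) :=
    fun v w => sphere_integrable (fun ω : E => |⟪ω, v⟫| * K ⟪ω, w⟫) (by fun_prop)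
  have hpos : 0 ≤ ∫ ω, ((|⟪(ω:E), e⟫| * K ⟪(ω:E), e⟫ + |⟪(ω:E), l⟫| * K ⟪(ω:E), l⟫) -
      (|⟪(ω:E), l⟫| * K ⟪(ω:E), e⟫ + |⟪(ω:E), e⟫| * K ⟪(ω:E), l⟫)) ∂(sg E) := by
    refine integral_nonneg fun ω => ?_
    have hω : ‖(ω:E)‖ = 1 := by simp
    have b1 : |⟪(ω:E), e⟫| ≤ 1 := (abs_real_inner_le_norm _ _).trans (by rw [hω, he]; norm_num)
    have b2 : |⟪(ω:E), l⟫| ≤ 1 := (abs_real_inner_le_norm _ _).trans (by rw [hω, hl]; norm_num)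
    have : (|⟪(ω:E), e⟫| * K ⟪(ω:E), e⟫ + |⟪(ω:E), l⟫| * K ⟪(ω:E), l⟫) -
      (|⟪(ω:E), l⟫| * K ⟪(ω:E), e⟫ + |⟪(ω:E), e⟫| * K ⟪(ω:E), l⟫) =
      (|⟪(ω:E), e⟫| - |⟪(ω:E), l⟫|) * (K ⟪(ω:E), e⟫ - K ⟪(ω:E), l⟫) := by ring
    simp only [Pi.zero_apply]
    rw [this]
    rcases le_total |⟪(ω:E), e⟫| |⟪(ω:E), l⟫| with h | h
    · exact mul_nonneg_of_nonpos_of_nonpos (by linarith) (by linarith [hKmono _ _ h b2])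
    · exact mul_nonneg (by linarith) (by linarith [hKmono _ _ h b1])
  have hsub := integral_sub ((hI e e).add (hI l l)) ((hI l e).add (hI e l))
  simp only [Pi.add_apply] at hsub
  rw [hsub, integral_add (hI _ _) (hI _ _),
    integral_add (hI _ _) (hI _ _), s1, s2, ← hsym, ← hsym] at hpos
  linarith

theorem kern (lam : ℝ) (hlam : 0 < lam) (hn : (finrank ℝ E : ℝ) = 2*lam+2) {x e l : E} (hx : ‖x‖ < 1)
    (he : ‖e‖ = 1) (hxe : x = ‖x‖ • e) (hl : ‖l‖ = 1) :
    ∫ ω, |dPt (finrank ℝ E) x l (ω:E)| ∂(sg E) ≤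
      finrank ℝ E / (1 - ‖x‖^2) * ∫ ω, |⟪(ω:E), e⟫ - lam*‖x‖/(lam+1)| *
        (max (1 + ‖x‖^2 - 2 * ‖x‖ * ⟪(ω:E), e⟫) ((1 - ‖x‖)^2)) ^ (-lam) ∂(sg E) := by
  have hρ : 0 < 1 - ‖x‖^2 := by nlinarith [norm_nonneg x]
  rw [kern_a lam hlam hn hx l, kern_b lam hlam hx he hxe l]
  calc _ ≤ finrank ℝ E / (1 - ‖x‖^2) *
        ∫ ω, |⟪(ω:E), e⟫| * kt (finrank ℝ E) lam ‖x‖ (lam*‖x‖/(lam+1)) ⟪(ω:E), e⟫ ∂(sg E) := by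
        exact mul_le_mul_of_nonneg_left
          (kern_c _ lam hlam hn (norm_nonneg x) hx rfl he hl) (by positivity)
    _ = _ := by
      rw [← kern_b lam hlam hx he hxe e, ← integral_const_mul]
      congr 1
      ext ω
      rw [Ft, Qt]
      have h1 : ⟪(ω:E), x⟫ = ‖x‖ * ⟪(ω:E), e⟫ := by
        conv_lhs => rw [hxe]
        rw [inner_smul_right]
      have h2 : ⟪(ω:E) - (lam/(lam+1)) • x, e⟫ = ⟪(ω:E), e⟫ - lam*‖x‖/(lam+1) := by
        rw [inner_sub_left, inner_smul_left]
        conv_lhs => rw [hxe]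
        rw [inner_smul_left, real_inner_self_eq_norm_sq, he]
        simp only [conj_trivial]
        ring
      rw [h1, h2]
      congr 4
      ring

end Kern
end Khav

namespace Khav
section Poisson
open MeasureTheory Set Metric Module
open scoped RealInnerProductSpace
variable {E : Type*} [NormedAddCommGroup E] [InnerProductSpace ℝ E]

noncomputable def Pk (n : ℕ) (x ζ : E) : ℝ := (1 - ‖x‖^2) * (‖x - ζ‖^2) ^ (-((n:ℝ)/2))

noncomputable def Pk1 (n : ℕ) (v x ζ : E) : ℝ :=
  -2 * ⟪x, v⟫ * (‖x - ζ‖^2) ^ (-((n:ℝ)/2))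
    - n * (1 - ‖x‖^2) * ⟪x - ζ, v⟫ * (‖x - ζ‖^2) ^ (-((n:ℝ)/2) - 1)

noncomputable def Pk2 (n : ℕ) (v x ζ : E) : ℝ :=
  -2 * ‖v‖^2 * (‖x - ζ‖^2) ^ (-((n:ℝ)/2))
    + 4 * n * ⟪x, v⟫ * ⟪x - ζ, v⟫ * (‖x - ζ‖^2) ^ (-((n:ℝ)/2) - 1)
    - n * (1 - ‖x‖^2) * ‖v‖^2 * (‖x - ζ‖^2) ^ (-((n:ℝ)/2) - 1)
    + n * (n+2) * (1 - ‖x‖^2) * ⟪x - ζ, v⟫^2 * (‖x - ζ‖^2) ^ (-((n:ℝ)/2) - 1 - 1)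

theorem line_sub (x v ζ : E) : HasDerivAt (fun t : ℝ => x + t • v - ζ) v 0 := by
  have : HasDerivAt (fun t : ℝ => t • v) ((1:ℝ) • v) 0 := (hasDerivAt_id (0:ℝ)).smul_const v
  simpa using (this.const_add x).sub_const ζ

theorem line_add (x v : E) : HasDerivAt (fun t : ℝ => x + t • v) v 0 := by
  simpa using line_sub x v 0

theorem line_q (x v ζ : E) :
    HasDerivAt (fun t : ℝ => ‖x + t • v - ζ‖^2) (2 * ⟪x - ζ, v⟫) 0 := by
  simpa using (line_sub x v ζ).norm_sq

theorem line_n (x v : E) :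
    HasDerivAt (fun t : ℝ => ‖x + t • v‖^2) (2 * ⟪x, v⟫) 0 := by
  simpa using (line_add x v).norm_sq

theorem line_qp (x v ζ : E) (h : x ≠ ζ) (p : ℝ) :
    HasDerivAt (fun t : ℝ => (‖x + t • v - ζ‖^2) ^ p)
      (2 * ⟪x - ζ, v⟫ * p * (‖x - ζ‖^2) ^ (p - 1)) 0 := by
  have h0 : ‖x + (0:ℝ) • v - ζ‖^2 ≠ 0 := by
    have : x - ζ ≠ 0 := sub_ne_zero.2 h
    simpa using this
  simpa using (line_q x v ζ).rpow_const (p := p) (Or.inl h0)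

theorem line_in (x v ζ : E) : HasDerivAt (fun t : ℝ => ⟪x + t • v - ζ, v⟫) (‖v‖^2) 0 := by
  have := (line_sub x v ζ).inner ℝ (hasDerivAt_const (0:ℝ) v)
  simpa using this

theorem line_in0 (x v : E) : HasDerivAt (fun t : ℝ => ⟪x + t • v, v⟫) (‖v‖^2) 0 := by
  simpa using line_in x v 0

theorem Pk_line (n : ℕ) (v x ζ : E) (h : x ≠ ζ) :
    HasLineDerivAt ℝ (fun x => Pk n x ζ) (Pk1 n v x ζ) x v := by
  have := ((line_n x v).const_sub 1).mul (line_qp x v ζ h (-((n:ℝ)/2)))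
  unfold HasLineDerivAt
  refine this.congr_deriv ?_
  simp only [zero_smul, add_zero, Pk1]
  ring

theorem Pk1_line (n : ℕ) (v x ζ : E) (h : x ≠ ζ) :
    HasLineDerivAt ℝ (fun x => Pk1 n v x ζ) (Pk2 n v x ζ) x v := by
  have h1 := ((line_in0 x v).const_mul (-2)).mul (line_qp x v ζ h (-((n:ℝ)/2)))
  have h2 := ((((line_n x v).const_sub 1).const_mul (n:ℝ)).mul (line_in x v ζ)).mul
    (line_qp x v ζ h (-((n:ℝ)/2) - 1))
  unfold HasLineDerivAt
  refine (h1.sub h2).congr_deriv ?_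
  simp only [zero_smul, add_zero, Pk2, Pi.mul_apply]
  ring

theorem Pk2_sum {ι : Type*} [Fintype ι] (b : OrthonormalBasis ι ℝ E) (n : ℕ)
    (hn : Fintype.card ι = n) (x ζ : E) (hζ : ‖ζ‖ = 1) (h : x ≠ ζ) :
    ∑ i, Pk2 n (b i) x ζ = 0 := by
  have hq : 0 < ‖x - ζ‖^2 := by
    have : x - ζ ≠ 0 := sub_ne_zero.2 h
    positivity
  have s1 : ∑ i, ⟪x, b i⟫ * ⟪x - ζ, b i⟫ = ⟪x, x - ζ⟫ := by
    rw [← b.sum_inner_mul_inner x (x - ζ)]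
    simp_rw [real_inner_comm (b _) (x - ζ)]
  have s2 : ∑ i, ⟪x - ζ, b i⟫^2 = ‖x - ζ‖^2 := by
    rw [← real_inner_self_eq_norm_sq, ← b.sum_inner_mul_inner (x - ζ) (x - ζ)]
    refine Finset.sum_congr rfl fun i _ => ?_
    rw [real_inner_comm (b i) (x - ζ), sq]
  simp only [Pk2]
  rw [Finset.sum_add_distrib, Finset.sum_sub_distrib, Finset.sum_add_distrib]
  have t1 : ∑ i, -2 * ‖b i‖^2 * (‖x - ζ‖^2) ^ (-((n:ℝ)/2)) = -2 * n * (‖x - ζ‖^2) ^ (-((n:ℝ)/2)) := by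
    simp [hn]; ring
  have t2 : ∑ i, 4 * n * ⟪x, b i⟫ * ⟪x - ζ, b i⟫ * (‖x - ζ‖^2) ^ (-((n:ℝ)/2) - 1) =
      4 * n * ⟪x, x - ζ⟫ * (‖x - ζ‖^2) ^ (-((n:ℝ)/2) - 1) := by
    rw [← s1, Finset.mul_sum, Finset.sum_mul]
    exact Finset.sum_congr rfl fun i _ => by ring
  have t3 : ∑ i, n * (1 - ‖x‖^2) * ‖b i‖^2 * (‖x - ζ‖^2) ^ (-((n:ℝ)/2) - 1) =
      n * n * (1 - ‖x‖^2) * (‖x - ζ‖^2) ^ (-((n:ℝ)/2) - 1) := by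
    simp [hn]; ring
  have t4 : ∑ i, n * (n+2) * (1 - ‖x‖^2) * ⟪x - ζ, b i⟫^2 * (‖x - ζ‖^2) ^ (-((n:ℝ)/2) - 1 - 1) =
      n * (n+2) * (1 - ‖x‖^2) * ‖x - ζ‖^2 * (‖x - ζ‖^2) ^ (-((n:ℝ)/2) - 1 - 1) := by
    rw [← s2, Finset.mul_sum, Finset.sum_mul]
  rw [t1, t2, t3, t4]
  rw [Real.rpow_sub_one hq.ne' (-((n:ℝ)/2) - 1), Real.rpow_sub_one hq.ne' (-((n:ℝ)/2))]
  have hq2 : ‖x - ζ‖^2 = ‖x‖^2 - 2 * ⟪x, ζ⟫ + 1 := by rw [norm_sub_sq_real, hζ]; ring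
  have hin : ⟪x, x - ζ⟫ = ‖x‖^2 - ⟪x, ζ⟫ := by rw [inner_sub_right, real_inner_self_eq_norm_sq]
  generalize (‖x - ζ‖^2) ^ (-((n:ℝ)/2)) = Y
  rw [hin]
  have hx2 : ‖x‖^2 = ‖x - ζ‖^2 + 2 * ⟪x, ζ⟫ - 1 := by linarith
  rw [hx2]
  generalize ‖x - ζ‖^2 = q at *
  field_simp
  ring

theorem shift_line (f : E → ℝ) (d : ℝ) (x v : E) (t0 : ℝ)
    (h : HasLineDerivAt ℝ f d (x + t0 • v) v) : HasDerivAt (fun t : ℝ => f (x + t • v)) d t0 := by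
  unfold HasLineDerivAt at h
  have h2 : HasDerivAt (fun t => f (x + t0 • v + t • v)) d (t0 - t0) := by simpa using h
  have := h2.comp_sub_const t0 t0
  refine this.congr_of_eventuallyEq (Filter.Eventually.of_forall fun t => ?_)
  simp only
  rw [add_assoc, ← add_smul, add_sub_cancel]

def LHarm {ι : Type*} [Fintype ι] (b : ι → E) (g : E → ℝ) : Prop :=
  ∃ g1 g2 : ι → E → ℝ, (∀ i, ∀ y ∈ ball (0:E) 1, HasLineDerivAt ℝ g (g1 i y) y (b i) ∧
    HasLineDerivAt ℝ (g1 i) (g2 i y) y (b i)) ∧ ∀ y ∈ ball (0:E) 1, ∑ i, g2 i y = 0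

theorem LHarm.smul_add {ι : Type*} [Fintype ι] {b : ι → E} {f g : E → ℝ} (hf : LHarm b f)
    (hg : LHarm b g) (α β : ℝ) : LHarm b (fun x => α * f x + β * g x) := by
  obtain ⟨f1, f2, hf, hf'⟩ := hf
  obtain ⟨g1, g2, hg, hg'⟩ := hg
  refine ⟨fun i y => α * f1 i y + β * g1 i y, fun i y => α * f2 i y + β * g2 i y, ?_, ?_⟩
  · intro i y hy
    exact ⟨((hf i y hy).1.const_mul α).add ((hg i y hy).1.const_mul β),
      ((hf i y hy).2.const_mul α).add ((hg i y hy).2.const_mul β)⟩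
  · intro y hy
    rw [Finset.sum_add_distrib, ← Finset.mul_sum, ← Finset.mul_sum, hf' y hy, hg' y hy]
    ring

theorem second_deriv_max (φ φ1 : ℝ → ℝ) (d : ℝ) (h1 : ∀ᶠ t in nhds 0, HasDerivAt φ (φ1 t) t)
    (h2 : HasDerivAt φ1 d 0) (hmax : IsLocalMax φ 0) : d ≤ 0 := by
  by_contra hd
  push Not at hd
  have e1 : deriv φ =ᶠ[nhds 0] φ1 := h1.mono fun t ht => ht.deriv
  have hdd : deriv (deriv φ) 0 = d := by rw [e1.deriv_eq, h2.deriv]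
  have hmin := isLocalMin_of_deriv_deriv_pos (f := φ) (x₀ := 0) (by rw [hdd]; exact hd)
    hmax.deriv_eq_zero h1.self_of_nhds.continuousAt
  have hc : φ =ᶠ[nhds 0] fun _ => φ 0 := by
    filter_upwards [hmax, hmin] with t ha hb
    exact le_antisymm ha hb
  have hc' : deriv φ =ᶠ[nhds 0] fun _ => 0 := by
    have := hc.deriv
    simpa using this
  rw [hc'.deriv_eq] at hdd
  simp at hdd
  linarith

theorem maxprin [FiniteDimensional ℝ E] {ι : Type*} [Fintype ι] [Nonempty ι] (b : ι → E)
    (hb : ∀ i, ‖b i‖ = 1) (g : E → ℝ)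
    (hc : ∀ r < 1, ContinuousOn g (closedBall 0 r)) (hg : LHarm b g)
    (hbd : ∀ ε > 0, ∃ r0 < 1, ∀ x : E, r0 ≤ ‖x‖ → ‖x‖ < 1 → g x ≤ ε) (x : E) (hx : ‖x‖ < 1) :
    g x ≤ 0 := by
  refine le_of_forall_pos_le_add fun ε hε => ?_
  obtain ⟨r0, hr0, hr⟩ := hbd (ε/2) (by positivity)
  set η := ε/2 with hη
  have hη0 : 0 < η := by positivity
  obtain ⟨r, hr1, hr2⟩ := exists_between (max_lt hr0 hx)
  have hr0' : r0 < r := (le_max_left _ _).trans_lt hr1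
  have hxr : ‖x‖ < r := (le_max_right _ _).trans_lt hr1
  let W : E → ℝ := fun y => g y + η * ‖y‖^2
  have hWc : ContinuousOn W (closedBall 0 r) := (hc r hr2).add (by fun_prop)
  obtain ⟨x0, hx0, hmax⟩ := (isCompact_closedBall (0:E) r).exists_isMaxOn
    ⟨x, by simpa using hxr.le⟩ hWc
  have hx0' : ‖x0‖ ≤ r := by simpa using hx0
  have hxmem : x ∈ closedBall (0:E) r := by simpa using hxr.le
  have hWx : W x ≤ W x0 := hmax hxmem
  rcases hx0'.eq_or_lt with h | h
  · have h1 := hr x0 (by rw [h]; exact hr0'.le) (by rw [h]; exact hr2)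
    have h2 : ‖x0‖^2 ≤ 1 := by
      have := norm_nonneg x0
      nlinarith
    have h3 : g x ≤ W x := by simp only [W]; nlinarith [sq_nonneg ‖x‖]
    have h4 : W x0 ≤ ε/2 + η := by simp only [W]; nlinarith
    linarith
  · exfalso
    obtain ⟨g1, g2, hg, hg'⟩ := hg
    have hball : ∀ y ∈ ball (0:E) 1, ∀ i, HasLineDerivAt ℝ W (g1 i y + η * (2 * ⟪y, b i⟫)) y (b i) ∧
        HasLineDerivAt ℝ (fun y => g1 i y + η * (2 * ⟪y, b i⟫)) (g2 i y + η * (2 * ‖b i‖^2)) y (b i) := by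
      intro y hy i
      exact ⟨(hg i y hy).1.add ((line_n y (b i)).const_mul η),
        (hg i y hy).2.add (((line_in0 y (b i)).const_mul 2).const_mul η)⟩
    have hx01 : x0 ∈ ball (0:E) 1 := by simpa using h.trans hr2
    have hle : ∀ i, g2 i x0 + η * (2 * ‖b i‖^2) ≤ 0 := by
      intro i
      have hcl : ContinuousAt (fun t : ℝ => x0 + t • b i) 0 := by fun_prop
      have hnear : ∀ᶠ t in nhds (0:ℝ), x0 + t • b i ∈ ball (0:E) r := by
        apply hcl.eventually_mem
        apply isOpen_ball.mem_nhds
        simpa using h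
      refine second_deriv_max (fun t : ℝ => W (x0 + t • b i))
        (fun t : ℝ => (fun y => g1 i y + η * (2 * ⟪y, b i⟫)) (x0 + t • b i)) _ ?_
        (hball x0 hx01 i).2 ?_
      · filter_upwards [hnear] with t ht
        exact shift_line _ _ _ _ _ (hball _ (ball_subset_ball hr2.le ht) i).1
      · filter_upwards [hnear] with t ht
        have := hmax (ball_subset_closedBall ht)
        simpa using this
    have hs : ∑ i, (g2 i x0 + η * (2 * ‖b i‖^2)) ≤ 0 := Finset.sum_nonpos fun i _ => hle i
    rw [Finset.sum_add_distrib, hg' x0 hx01] at hs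
    have : 0 < ∑ i, η * (2 * ‖b i‖^2) := by
      apply Finset.sum_pos
      · intro i _; rw [hb i]; positivity
      · exact Finset.univ_nonempty
    linarith

end Poisson
end Khav

namespace Khav
section PoissonInt
open MeasureTheory Set Metric Module
open scoped RealInnerProductSpace
variable {E : Type*} [NormedAddCommGroup E] [InnerProductSpace ℝ E]

theorem ne_of_ball_sphere {x ζ : E} (hx : ‖x‖ < 1) (hζ : ‖ζ‖ = 1) : x ≠ ζ := by
  rintro rfl; linarith

theorem q_cont (p : ℝ) : ContinuousOn (fun z : E × E => (‖z.1 - z.2‖^2) ^ p)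
    (ball 0 1 ×ˢ sphere 0 1) := by
  refine ContinuousOn.rpow_const (by fun_prop) (fun z hz => Or.inl ?_)
  have h1 : ‖z.1‖ < 1 := by simpa using hz.1
  have h2 : ‖z.2‖ = 1 := by simpa using hz.2
  have := sub_ne_zero.2 (ne_of_ball_sphere h1 h2)
  positivity

theorem Pk_cont (n : ℕ) : ContinuousOn (fun z : E × E => Pk n z.1 z.2) (ball 0 1 ×ˢ sphere 0 1) := by
  unfold Pk
  exact ContinuousOn.mul (by fun_prop) (q_cont _)

theorem Pk1_cont (n : ℕ) (v : E) :
    ContinuousOn (fun z : E × E => Pk1 n v z.1 z.2) (ball 0 1 ×ˢ sphere 0 1) := by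
  unfold Pk1
  exact (ContinuousOn.mul (by fun_prop) (q_cont _)).sub (ContinuousOn.mul (by fun_prop) (q_cont _))

theorem Pk2_cont (n : ℕ) (v : E) :
    ContinuousOn (fun z : E × E => Pk2 n v z.1 z.2) (ball 0 1 ×ˢ sphere 0 1) := by
  unfold Pk2
  exact (((ContinuousOn.mul (by fun_prop) (q_cont _)).add
    (ContinuousOn.mul (by fun_prop) (q_cont _))).sub
    (ContinuousOn.mul (by fun_prop) (q_cont _))).add (ContinuousOn.mul (by fun_prop) (q_cont _))

theorem Pk_eq (n : ℕ) (x ζ : E) (h : x ≠ ζ) : Pk n x ζ = (1 - ‖x‖^2) / ‖x - ζ‖ ^ n := by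
  have hq : 0 < ‖x - ζ‖ := norm_pos_iff.2 (sub_ne_zero.2 h)
  rw [Pk, div_eq_mul_inv]
  congr 1
  rw [← Real.rpow_natCast ‖x - ζ‖ 2, ← Real.rpow_mul hq.le, ← Real.rpow_natCast, ← Real.rpow_neg hq.le]
  congr 1
  push_cast; ring

theorem max_sphere (x ζ : E) (hζ : ‖ζ‖ = 1) : max ‖x - ζ‖ (1 - ‖x‖) = ‖x - ζ‖ := by
  apply max_eq_left
  have := norm_sub_norm_le ζ x
  rw [norm_sub_rev, hζ] at this
  exact this

theorem Pk1_eq (n : ℕ) (v x ζ : E) (hζ : ‖ζ‖ = 1) (h : x ≠ ζ) : Pk1 n v x ζ = dPt n x v ζ := by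
  have hq : 0 < ‖x - ζ‖ := norm_pos_iff.2 (sub_ne_zero.2 h)
  have e : ∀ m : ℕ, (‖x - ζ‖^2) ^ (-((m:ℝ)/2)) = (‖x - ζ‖ ^ m)⁻¹ := by
    intro m
    rw [← Real.rpow_natCast ‖x - ζ‖ 2, ← Real.rpow_mul hq.le, ← Real.rpow_natCast, ← Real.rpow_neg hq.le]
    congr 1
    push_cast; ring
  have e2 : -((n:ℝ)/2) - 1 = -(((n+2:ℕ):ℝ)/2) := by push_cast; ring
  rw [Pk1, dPt, max_sphere x ζ hζ, e2, e, e]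
  ring

variable [FiniteDimensional ℝ E] [MeasurableSpace E] [BorelSpace E] [Nontrivial E]

theorem sph_int (f : sphere (0:E) 1 → ℝ) (hf : Continuous f) : Integrable f (sg E) :=
  hf.integrable_of_hasCompactSupport (HasCompactSupport.of_compactSpace _)

theorem slice_cont (A : E → E → ℝ)
    (hA : ContinuousOn (fun z : E × E => A z.1 z.2) (ball 0 1 ×ˢ sphere 0 1)) {x : E} (hx : ‖x‖ < 1) :
    Continuous (fun ω : sphere (0:E) 1 => A x ω) :=
  hA.comp_continuous (f := fun ω : sphere (0:E) 1 => (x, (ω:E))) (by fun_prop)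
    (fun ω => ⟨by simpa using hx, ω.2⟩)

theorem line_dui (A B : E → E → ℝ) (v : E)
    (hA : ContinuousOn (fun z : E × E => A z.1 z.2) (ball 0 1 ×ˢ sphere 0 1))
    (hB : ContinuousOn (fun z : E × E => B z.1 z.2) (ball 0 1 ×ˢ sphere 0 1))
    (hAB : ∀ y, ‖y‖ < 1 → ∀ ζ : E, ‖ζ‖ = 1 → HasLineDerivAt ℝ (fun y => A y ζ) (B y ζ) y v)
    (w : sphere (0:E) 1 → ℝ) (hw : Continuous w) (x : E) (hx : ‖x‖ < 1) :
    HasLineDerivAt ℝ (fun x => ∫ ω, A x (ω:E) * w ω ∂(sg E)) (∫ ω, B x (ω:E) * w ω ∂(sg E)) x v := by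
  unfold HasLineDerivAt
  have hcl : ContinuousAt (fun t : ℝ => x + t • v) 0 := by fun_prop
  have hnear : ∀ᶠ t in nhds (0:ℝ), x + t • v ∈ ball (0:E) 1 := by
    apply hcl.eventually_mem
    apply isOpen_ball.mem_nhds
    simpa using hx
  obtain ⟨δ, hδ, hδ'⟩ := Metric.nhds_basis_closedBall.mem_iff.1 hnear
  have hin : ∀ t ∈ Icc (0-δ) (0+δ), ‖x + t • v‖ < 1 := by
    intro t ht
    have : t ∈ closedBall (0:ℝ) δ := by rw [Real.closedBall_eq_Icc]; exact ht
    simpa using hδ' this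
  have key := dui (sg E) (fun t ω => A (x + t • v) (ω:E) * w ω)
    (fun t ω => B (x + t • v) (ω:E) * w ω) 0 δ hδ ?_ ?_ ?_
  · simpa using key
  · intro t ht
    exact (slice_cont A hA (hin t ht)).mul hw
  · refine ContinuousOn.mul ?_ (by fun_prop)
    exact hB.comp (f := fun z : ℝ × sphere (0:E) 1 => (x + z.1 • v, (z.2:E))) (by fun_prop)
      (fun z hz => ⟨by simpa using hin z.1 hz.1, z.2.2⟩)
  · intro t ht ω
    exact (shift_line _ _ _ _ _ (hAB _ (hin t ht) (ω:E) (by simp))).mul_const (w ω)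

noncomputable def Ph (w : sphere (0:E) 1 → ℝ) (x : E) : ℝ :=
  ∫ ω, Pk (finrank ℝ E) x (ω:E) * w ω ∂(sg E)

theorem Ph_line (w : sphere (0:E) 1 → ℝ) (hw : Continuous w) (v x : E) (hx : ‖x‖ < 1) :
    HasLineDerivAt ℝ (Ph w) (∫ ω, Pk1 (finrank ℝ E) v x (ω:E) * w ω ∂(sg E)) x v :=
  line_dui (Pk (finrank ℝ E)) (Pk1 (finrank ℝ E) v) v (Pk_cont _) (Pk1_cont _ _)
    (fun _ hy _ hζ => Pk_line _ _ _ _ (ne_of_ball_sphere hy hζ)) w hw x hx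

theorem Ph_line1 (w : sphere (0:E) 1 → ℝ) (hw : Continuous w) (v x : E) (hx : ‖x‖ < 1) :
    HasLineDerivAt ℝ (fun x => ∫ ω, Pk1 (finrank ℝ E) v x (ω:E) * w ω ∂(sg E))
      (∫ ω, Pk2 (finrank ℝ E) v x (ω:E) * w ω ∂(sg E)) x v :=
  line_dui (Pk1 (finrank ℝ E) v) (Pk2 (finrank ℝ E) v) v (Pk1_cont _ _) (Pk2_cont _ _)
    (fun _ hy _ hζ => Pk1_line _ _ _ _ (ne_of_ball_sphere hy hζ)) w hw x hx

theorem Ph_harm {ι : Type*} [Fintype ι] (b : OrthonormalBasis ι ℝ E) (w : sphere (0:E) 1 → ℝ)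
    (hw : Continuous w) : LHarm b (Ph w) := by
  refine ⟨fun i y => ∫ ω, Pk1 (finrank ℝ E) (b i) y (ω:E) * w ω ∂(sg E),
    fun i y => ∫ ω, Pk2 (finrank ℝ E) (b i) y (ω:E) * w ω ∂(sg E), ?_, ?_⟩
  · intro i y hy
    have hy' : ‖y‖ < 1 := by simpa using hy
    exact ⟨Ph_line w hw (b i) y hy', Ph_line1 w hw (b i) y hy'⟩
  · intro y hy
    have hy' : ‖y‖ < 1 := by simpa using hy
    rw [← integral_finset_sum]
    · have : ∀ ω : sphere (0:E) 1, ∑ i, Pk2 (finrank ℝ E) (b i) y (ω:E) * w ω = 0 := by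
        intro ω
        rw [← Finset.sum_mul, Pk2_sum b _ (finrank_eq_card_basis b.toBasis).symm y ω (by simp)
          (ne_of_ball_sphere hy' (by simp)), zero_mul]
      simp [this]
    · intro i _
      exact sph_int _ ((slice_cont _ (Pk2_cont _ (b i)) hy').mul hw)

theorem Ph_cont (w : sphere (0:E) 1 → ℝ) (hw : Continuous w) (r : ℝ) (hr : r < 1) :
    ContinuousOn (Ph w) (closedBall 0 r) := by
  have h1 : Continuous (fun x : E => ∫ ω in (univ : Set (sphere (0:E) 1)),
      ((1 - ‖x‖^2) * (max (‖x - (ω:E)‖^2) ((1-r)^2)) ^ (-((finrank ℝ E:ℝ)/2))) * w ω ∂(sg E)) := by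
    refine continuous_parametric_integral_of_continuous ?_ isCompact_univ
    refine Continuous.mul (Continuous.mul (by fun_prop) ?_) (by fun_prop)
    refine Continuous.rpow_const (by fun_prop) (fun z => Or.inl ?_)
    exact (lt_of_lt_of_le (by nlinarith : 0 < (1-r)^2) (le_max_right _ _)).ne'
  refine h1.continuousOn.congr fun x hx => ?_
  simp only [Measure.restrict_univ, Ph, Pk]
  congr 1
  ext ω
  have hx' : ‖x‖ ≤ r := by simpa using hx
  have := norm_sub_norm_le (ω:E) x
  rw [norm_sub_rev] at this
  have hω : ‖(ω:E)‖ = 1 := by simp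
  rw [hω] at this
  rw [max_eq_left]
  have h0 : 0 ≤ 1 - r := by linarith
  have h2 : 1 - r ≤ ‖x - (ω:E)‖ := by linarith
  gcongr

theorem Pk_total {x : E} (hx : ‖x‖ < 1) :
    ∫ ω, Pk (finrank ℝ E) x (ω:E) ∂(sg E) = (sg E).real univ := by
  set n := finrank ℝ E with hndef
  have hn1 : 1 ≤ n := Module.finrank_pos
  obtain ⟨m, hm⟩ : ∃ m, n = m + 1 := ⟨n-1, by omega⟩
  have hρ : 0 < 1 - ‖x‖^2 := by nlinarith [norm_nonneg x]
  have e1 : ∀ ω : sphere (0:E) 1, Pk n x (ω:E) = (1 - ‖x‖^2) / (max ‖x - (ω:E)‖ (1 - ‖x‖)) ^ n := by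
    intro ω
    rw [max_sphere x ω (by simp), Pk_eq _ _ _ (ne_of_ball_sphere hx (by simp))]
  simp_rw [e1]
  have hc : Continuous (fun ζ : E => (1 - ‖x‖^2) / (max ‖x - ζ‖ (1 - ‖x‖)) ^ n) := by
    refine Continuous.div (by fun_prop) (by fun_prop) (fun ζ => ?_)
    exact pow_ne_zero _ (lt_of_lt_of_le (by linarith) (le_max_right _ _)).ne'
  rw [cone _ hc hx, ← hndef]
  have hD := Dl_cont x 1
  have hL := Ll_cont x 1
  let G : E → ℝ := fun ω => (1 - ‖x‖^2) / (Ll x 1 ω * Dl x 1 ω)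
  have hG : Continuous G := by
    refine Continuous.div (by fun_prop) (by fun_prop) (fun ζ => ?_)
    exact mul_ne_zero (Ll_pos hx ζ).ne' (Dl_pos hx ζ).ne'
  have e2 : ∀ ω : sphere (0:E) 1, Ll x 1 (ω:E) ^ (n-1) * ((1 - ‖x‖^2) /
      (max ‖x - (x + Ll x 1 (ω:E) • (ω:E))‖ (1 - ‖x‖)) ^ n) * (1 / Dl x 1 (ω:E)) = G ω := by
    intro ω
    have hω : ‖(ω:E)‖ = 1 := by simp
    have hLp := Ll_pos hx (ω:E)
    have hDp := Dl_pos hx (ω:E)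
    rw [max_sphere _ _ (norm_ray hx (ω:E) hω), sub_add_cancel_left, norm_neg, norm_smul, hω, mul_one,
      Real.norm_eq_abs, abs_of_pos hLp, hm, Nat.add_sub_cancel]
    simp only [G]
    field_simp
    ring
  simp_rw [e2]
  have h1 := sphere_neg G hG
  have h2 : ∫ ω, (G (ω:E) + G (-(ω:E))) ∂(sg E) = 2 * (sg E).real univ := by
    have : ∀ ω : sphere (0:E) 1, G (ω:E) + G (-(ω:E)) = 2 := by
      intro ω
      have hLp := Ll_pos hx (ω:E)
      have hLp' := Ll_pos hx (-(ω:E))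
      have hDp := Dl_pos hx (ω:E)
      have a1 := Ll_mul_neg hx (ω:E)
      have a2 := Ll_add_neg (p := x) (τ := 1) (ω:E)
      simp only [G]
      rw [Dl_neg]
      have hh : 1 - ‖x‖^2 = Ll x 1 (ω:E) * Ll x 1 (-(ω:E)) := by rw [a1]; norm_num
      rw [hh]
      field_simp
      linarith
    simp_rw [this]
    simp [mul_comm]
  rw [integral_add (sphere_integrable G hG)
    (sphere_integrable (fun z => G (-z)) (hG.comp continuous_neg)), h1] at h2
  linarith

theorem Ph_boundary (w : E → ℝ) (hw : ContinuousOn w (closedBall 0 1)) (ε : ℝ) (hε : 0 < ε) :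
    ∃ r0 < 1, ∀ x : E, r0 ≤ ‖x‖ → ‖x‖ < 1 →
      |(sg E).real univ * w x - Ph (fun ω => w ω) x| ≤ ε * (sg E).real univ := by
  set n := finrank ℝ E with hndef
  have huc := (isCompact_closedBall (0:E) 1).uniformContinuousOn_of_continuous hw
  rw [Metric.uniformContinuousOn_iff] at huc
  obtain ⟨δ, hδ, hu⟩ := huc (ε/2) (by positivity)
  obtain ⟨M, hM⟩ := (isCompact_closedBall (0:E) 1).exists_bound_of_continuousOn hw
  have hM0 : 0 ≤ M := (norm_nonneg _).trans (hM 0 (by simp))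
  have hδn : 0 < δ^n := by positivity
  set κ := ε * δ^n / (8 * (M + 1)) with hκ
  have hκ0 : 0 < κ := by positivity
  have hwS : Continuous (fun ω : sphere (0:E) 1 => w ω) :=
    hw.comp_continuous continuous_subtype_val (fun ω => sphere_subset_closedBall ω.2)
  refine ⟨1 - κ, by linarith, fun x hx1 hx2 => ?_⟩
  have hρ : 0 < 1 - ‖x‖^2 := by nlinarith [norm_nonneg x]
  have hρ2 : 1 - ‖x‖^2 ≤ 2 * κ := by nlinarith [norm_nonneg x]
  have hPc := slice_cont (fun a b => Pk n a b) (Pk_cont n) hx2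
  have e1 : (sg E).real univ * w x - Ph (fun ω => w ω) x =
      ∫ ω, Pk n x (ω:E) * (w x - w ω) ∂(sg E) := by
    have : ∀ ω : sphere (0:E) 1, Pk n x (ω:E) * (w x - w ω) = Pk n x (ω:E) * w x - Pk n x (ω:E) * w ω :=
      fun ω => by ring
    simp_rw [this]
    rw [integral_sub, integral_mul_const, Pk_total hx2, Ph]
    · exact sph_int _ (hPc.mul continuous_const)
    · exact sph_int _ (hPc.mul hwS)
  rw [e1]
  have hpt : ∀ ω : sphere (0:E) 1, ‖Pk n x (ω:E) * (w x - w ω)‖ ≤ Pk n x (ω:E) * (ε/2) + ε/2 := by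
    intro ω
    have hω : ‖(ω:E)‖ = 1 := by simp
    have hne := ne_of_ball_sphere hx2 hω
    have hq : 0 < ‖x - (ω:E)‖ := norm_pos_iff.2 (sub_ne_zero.2 hne)
    have hP := Pk_eq n x (ω:E) hne
    have hP0 : 0 < Pk n x (ω:E) := by rw [hP]; positivity
    have hxm : x ∈ closedBall (0:E) 1 := by simpa using hx2.le
    have hωm : (ω:E) ∈ closedBall (0:E) 1 := sphere_subset_closedBall ω.2
    rw [norm_mul, Real.norm_eq_abs, abs_of_pos hP0]
    rcases lt_or_ge (dist x (ω:E)) δ with h | h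
    · have h1 := hu x hxm ω hωm h
      rw [Real.dist_eq] at h1
      have : Pk n x (ω:E) * ‖w x - w ω‖ ≤ Pk n x (ω:E) * (ε/2) := by
        gcongr
        exact h1.le
      linarith
    · rw [dist_eq_norm] at h
      have h1 : Pk n x (ω:E) ≤ 2 * κ / δ^n := by
        rw [hP]
        gcongr
      have h2 : ‖w x - w ω‖ ≤ 2 * (M+1) := by
        refine (norm_sub_le _ _).trans ?_
        linarith [hM x hxm, hM ω hωm]
      have h3 : Pk n x (ω:E) * ‖w x - w ω‖ ≤ 2 * κ / δ^n * (2 * (M+1)) := by gcongr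
      have h4 : 2 * κ / δ^n * (2 * (M+1)) = ε/2 := by
        rw [hκ]
        field_simp
        norm_num
      have h5 : 0 ≤ Pk n x (ω:E) * (ε/2) := by positivity
      linarith
  have hi : Integrable (fun ω : sphere (0:E) 1 => Pk n x (ω:E) * (ε/2)) (sg E) :=
    sph_int _ (hPc.mul continuous_const)
  have h6 := norm_integral_le_of_norm_le
    (hi.add (integrable_const (ε/2)))
    (Filter.Eventually.of_forall hpt)
  simp only [Pi.add_apply] at h6
  rw [integral_add hi (integrable_const (ε/2)),
    integral_mul_const, Pk_total hx2, integral_const, Real.norm_eq_abs] at h6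
  refine h6.trans (le_of_eq ?_)
  simp only [smul_eq_mul]
  ring

theorem sg_pos : 0 < (sg E).real univ := by
  rw [Measure.toSphere_real_apply_univ]
  have h1 : 0 < finrank ℝ E := Module.finrank_pos
  have h2 : 0 < (volume : Measure E).real (ball 0 1) :=
    ENNReal.toReal_pos (measure_ball_pos volume 0 one_pos).ne' measure_ball_lt_top.ne
  positivity

theorem poisson {ι : Type*} [Fintype ι] [Nonempty ι] (b : OrthonormalBasis ι ℝ E)
    (w : E → ℝ) (hw : ContinuousOn w (closedBall 0 1)) (hh : LHarm b w) (x : E) (hx : ‖x‖ < 1) :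
    (sg E).real univ * w x = Ph (fun ω => w ω) x := by
  have hwS : Continuous (fun ω : sphere (0:E) 1 => w ω) :=
    hw.comp_continuous continuous_subtype_val (fun ω => sphere_subset_closedBall ω.2)
  have hs := sg_pos (E := E)
  have main : ∀ s : ℝ, |s| = 1 → s * (sg E).real univ * w x + (-s) * Ph (fun ω => w ω) x ≤ 0 := by
    intro s hs1
    refine maxprin b (fun i => b.norm_eq_one i)
      (fun x => s * (sg E).real univ * w x + (-s) * Ph (fun ω => w ω) x) ?_
      (hh.smul_add (Ph_harm b _ hwS) _ _) ?_ x hx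
    · intro r hr
      have h1 := hw.mono (closedBall_subset_closedBall hr.le)
      have h2 := Ph_cont _ hwS r hr
      fun_prop
    · intro ε hε
      obtain ⟨r0, hr0, h⟩ := Ph_boundary w hw (ε / (sg E).real univ) (by positivity)
      refine ⟨r0, hr0, fun x h1 h2 => ?_⟩
      have h3 := h x h1 h2
      rw [div_mul_cancel₀ _ hs.ne'] at h3
      have h4 : s * (sg E).real univ * w x + (-s) * Ph (fun ω => w ω) x =
        s * ((sg E).real univ * w x - Ph (fun ω => w ω) x) := by ring
      rw [h4]
      refine (le_abs_self _).trans ?_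
      rw [abs_mul, hs1, one_mul]
      exact h3
  have h1 := main 1 (by simp)
  have h2 := main (-1) (by simp)
  linarith

theorem line_bound {ι : Type*} [Fintype ι] [Nonempty ι] (b : OrthonormalBasis ι ℝ E)
    (w : E → ℝ) (hw : ContinuousOn w (closedBall 0 1)) (hh : LHarm b w) (M : ℝ)
    (hM : ∀ y ∈ closedBall (0:E) 1, |w y| ≤ M) (x : E) (hx : ‖x‖ < 1) (l : E) (d : ℝ)
    (hd : HasLineDerivAt ℝ w d x l) :
    (sg E).real univ * |d| ≤ M * ∫ ω, |dPt (finrank ℝ E) x l (ω:E)| ∂(sg E) := by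
  have hwS : Continuous (fun ω : sphere (0:E) 1 => w ω) :=
    hw.comp_continuous continuous_subtype_val (fun ω => sphere_subset_closedBall ω.2)
  have h1 := Ph_line _ hwS l x hx
  have h2 : HasLineDerivAt ℝ (Ph (fun ω : sphere (0:E) 1 => w ω)) ((sg E).real univ * d) x l := by
    unfold HasLineDerivAt at hd ⊢
    have h3 := hd.const_mul ((sg E).real univ)
    refine h3.congr_of_eventuallyEq ?_
    have hcl : ContinuousAt (fun t : ℝ => x + t • l) 0 := by fun_prop
    have hnear : ∀ᶠ t in nhds (0:ℝ), x + t • l ∈ ball (0:E) 1 := by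
      apply hcl.eventually_mem
      apply isOpen_ball.mem_nhds
      simpa using hx
    filter_upwards [hnear] with t ht
    exact (poisson b w hw hh _ (by simpa using ht)).symm
  have h3 : (sg E).real univ * d = _ := HasDerivAt.unique h2 h1
  have hs := sg_pos (E := E)
  have hab : (sg E).real univ * |d| = |(sg E).real univ * d| := by rw [abs_mul, abs_of_pos hs]
  rw [hab, h3, ← integral_const_mul, ← Real.norm_eq_abs]
  have hdc := dPt_cont (finrank ℝ E) hx l
  refine norm_integral_le_of_norm_le ?_ (Filter.Eventually.of_forall fun ω => ?_)
  · exact sphere_integrable (fun z => M * |dPt (finrank ℝ E) x l z|) (by fun_prop)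
  · rw [Pk1_eq _ _ _ _ (by simp) (ne_of_ball_sphere hx (by simp)), norm_mul, mul_comm,
      Real.norm_eq_abs, Real.norm_eq_abs]
    gcongr
    exact hM _ (sphere_subset_closedBall ω.2)

end PoissonInt
end Khav

namespace Khav
section Final
open MeasureTheory Set Metric Module
open scoped RealInnerProductSpace

theorem dil_line {E : Type*} [NormedAddCommGroup E] [NormedSpace ℝ E] (f : E → ℝ) (R : ℝ) (y v : E)
    (hf : DifferentiableAt ℝ f (R • y)) :
    HasLineDerivAt ℝ (fun y => f (R • y)) (R * fderiv ℝ f (R • y) v) y v := by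
  have h1 : HasFDerivAt (fun y : E => R • y)
    (R • ContinuousLinearMap.id ℝ E) y := (hasFDerivAt_id y).const_smul R
  have h2 := (hf.hasFDerivAt.comp y h1).hasLineDerivAt v
  have h3 : (fderiv ℝ f (R • y) ∘SL (R • ContinuousLinearMap.id ℝ E)) v = R * fderiv ℝ f (R • y) v := by
    simp
  rw [h3] at h2
  exact h2

theorem cx_eq (m : ℕ) (hm : 2 ≤ m) (ρ : ℝ) (h0 : 0 ≤ ρ) (h1 : ρ < 1)
    (e : EuclideanSpace ℝ (Fin (m+1))) (he : ‖e‖ = 1) :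
    ∫ ω, |⟪(ω:EuclideanSpace ℝ (Fin (m+1))), e⟫ - (((m:ℝ)-1)/2) * ρ / (((m:ℝ)-1)/2+1)| *
      (max (1+ρ^2-2*ρ*⟪(ω:EuclideanSpace ℝ (Fin (m+1))), e⟫) ((1-ρ)^2))^(-(((m:ℝ)-1)/2))
        ∂(sg (EuclideanSpace ℝ (Fin (m+1)))) =
    (volume : Measure (EuclideanSpace ℝ (Fin m))).real (ball 0 1) * (m *
      ∫ t in (-1:ℝ)..1, |t - (((m+1:ℕ):ℝ)-2)/(m+1:ℕ) * ρ| * (1 - t^2) ^ ((((m+1:ℕ):ℝ)-3)/2)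
              * (1 - 2*t*ρ + ρ^2) ^ (-((((m+1:ℕ):ℝ)-2)/2))) := by
  have hm' : (2:ℝ) ≤ m := by exact_mod_cast hm
  have hg : Continuous (fun t : ℝ => |t - (((m:ℝ)-1)/2) * ρ / (((m:ℝ)-1)/2+1)| *
      (max (1+ρ^2-2*ρ*t) ((1-ρ)^2))^(-(((m:ℝ)-1)/2))) := by
    refine Continuous.mul (by fun_prop) (Continuous.rpow_const (by fun_prop) fun t => Or.inl ?_)
    have : 0 < (1-ρ)^2 := by
      have : 0 < 1 - ρ := by linarith
      positivity
    exact (lt_of_lt_of_le this (le_max_right _ _)).ne'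
  rw [oneD m hm _ hg e he]
  congr 2
  refine intervalIntegral.integral_congr fun t ht => ?_
  rw [uIcc_of_le (by norm_num)] at ht
  beta_reduce
  have hmx : max (1+ρ^2-2*ρ*t) ((1-ρ)^2) = 1 - 2*t*ρ + ρ^2 := by
    rw [max_eq_left]
    · ring
    · nlinarith [ht.2]
  have ha : (((m:ℝ)-1)/2) * ρ / (((m:ℝ)-1)/2+1) = (((m+1:ℕ):ℝ)-2)/(m+1:ℕ) * ρ := by
    push_cast
    have : (m:ℝ) - 1 + 2 ≠ 0 := by linarith
    have : (m:ℝ) + 1 ≠ 0 := by linarith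
    have h2 : ((m:ℝ)-1)/2+1 = (m+1)/2 := by ring
    rw [h2]
    field_simp
    ring
  have hb : (((m+1:ℕ):ℝ)-3)/2 = ((m:ℝ)-2)/2 := by push_cast; ring
  have hc : (((m+1:ℕ):ℝ)-2)/2 = ((m:ℝ)-1)/2 := by push_cast; ring
  rw [hmx, ha, hb, hc]
  ring

theorem dil_harm (n : ℕ) (u : EuclideanSpace ℝ (Fin n) → ℝ)
    (hc : ContDiffOn ℝ 2 u (ball 0 1))
    (hl : ∀ x ∈ ball (0:EuclideanSpace ℝ (Fin n)) 1,
      (∑ i : Fin n, fderiv ℝ (fun y => fderiv ℝ u y (EuclideanSpace.single i 1)) x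
      (EuclideanSpace.single i 1)) = 0) (R : ℝ) (hR : 0 < R) (hR1 : R < 1) :
    LHarm (EuclideanSpace.basisFun (Fin n) ℝ) (fun y => u (R • y)) := by
  have hmem : ∀ y ∈ ball (0:EuclideanSpace ℝ (Fin n)) 1, R • y ∈ ball (0:EuclideanSpace ℝ (Fin n)) 1 := by
    intro y hy
    have : ‖y‖ < 1 := by simpa using hy
    simp only [mem_ball_zero_iff, norm_smul, Real.norm_eq_abs, abs_of_pos hR]
    nlinarith [norm_nonneg y]
  have key : ∀ (f : EuclideanSpace ℝ (Fin n) → ℝ) (y v : EuclideanSpace ℝ (Fin n)),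
      DifferentiableAt ℝ f (R • y) →
      HasLineDerivAt ℝ (fun y => f (R • y)) (R * fderiv ℝ f (R • y) v) y v := by
    intro f y v hf
    exact dil_line f R y v hf
  refine ⟨fun i y => R * fderiv ℝ u (R • y) (EuclideanSpace.single i 1),
    fun i y => R * (R * fderiv ℝ (fun y => fderiv ℝ u y (EuclideanSpace.single i 1)) (R • y)
      (EuclideanSpace.single i 1)), ?_, ?_⟩
  · intro i y hy
    have hcd := hc.contDiffAt (isOpen_ball.mem_nhds (hmem y hy))
    have hd := hcd.differentiableAt (by norm_num)
    have hd2 : DifferentiableAt ℝ (fderiv ℝ u) (R • y) :=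
      (hcd.fderiv_right (m := 1) (by norm_num)).differentiableAt (by norm_num)
    rw [EuclideanSpace.basisFun_apply]
    refine ⟨key _ _ _ hd, ?_⟩
    have := key (fun y => fderiv ℝ u y (EuclideanSpace.single i 1)) y (EuclideanSpace.single i 1)
      (hd2.clm_apply (differentiableAt_const _))
    unfold HasLineDerivAt at this ⊢
    exact this.const_mul R
  · intro y hy
    simp only [← Finset.mul_sum, hl _ (hmem y hy), mul_zero]

theorem final (m : ℕ) (hm : 2 ≤ m) (u : EuclideanSpace ℝ (Fin (m+1)) → ℝ)
    (hc : ContDiffOn ℝ 2 u (ball 0 1))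
    (hl : ∀ x ∈ ball (0:EuclideanSpace ℝ (Fin (m+1))) 1,
      (∑ i : Fin (m+1), fderiv ℝ (fun y => fderiv ℝ u y (EuclideanSpace.single i 1)) x
      (EuclideanSpace.single i 1)) = 0)
    (M : ℝ) (hb : ∀ y ∈ ball (0 : EuclideanSpace ℝ (Fin (m+1))) 1, |u y| ≤ M)
    (x : EuclideanSpace ℝ (Fin (m+1))) (hx : ‖x‖ < 1) :
    ‖fderiv ℝ u x‖ ≤ (((m+1:ℕ):ℝ)-1) * (volume : Measure (EuclideanSpace ℝ (Fin m))).real (ball 0 1)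
        / (volume : Measure (EuclideanSpace ℝ (Fin (m+1)))).real (ball 0 1)
          * (∫ t in (-1:ℝ)..1, |t - (((m+1:ℕ):ℝ)-2)/(m+1:ℕ) * ‖x‖| * (1 - t^2) ^ ((((m+1:ℕ):ℝ)-3)/2)
              * (1 - 2*t*‖x‖ + ‖x‖^2) ^ (-((((m+1:ℕ):ℝ)-2)/2)))
          * (1 / (1 - ‖x‖^2)) * M := by
  have hm' : (2:ℝ) ≤ m := by exact_mod_cast hm
  have hM : 0 ≤ M := (abs_nonneg _).trans (hb 0 (by simp))
  obtain ⟨e, he, hxe⟩ : ∃ e : EuclideanSpace ℝ (Fin (m+1)), ‖e‖ = 1 ∧ x = ‖x‖ • e := by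
    by_cases h : x = 0
    · exact ⟨EuclideanSpace.single 0 1, by simp, by simp [h]⟩
    · refine ⟨‖x‖⁻¹ • x, norm_smul_inv_norm h, ?_⟩
      rw [smul_inv_smul₀ (norm_ne_zero_iff.2 h)]
  have hfr : finrank ℝ (EuclideanSpace ℝ (Fin (m+1))) = m+1 := by simp
  have hcx := cx_eq m hm ‖x‖ (norm_nonneg _) hx e he
  set I := ∫ t in (-1:ℝ)..1, |t - (((m+1:ℕ):ℝ)-2)/(m+1:ℕ) * ‖x‖| * (1 - t^2) ^ ((((m+1:ℕ):ℝ)-3)/2)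
              * (1 - 2*t*‖x‖ + ‖x‖^2) ^ (-((((m+1:ℕ):ℝ)-2)/2)) with hI
  set vm := (volume : Measure (EuclideanSpace ℝ (Fin m))).real (ball 0 1) with hvm
  set vn := (volume : Measure (EuclideanSpace ℝ (Fin (m+1)))).real (ball 0 1) with hvn
  have hvn0 : 0 < vn := ENNReal.toReal_pos (measure_ball_pos volume 0 one_pos).ne' measure_ball_lt_top.ne
  have hsg : (sg (EuclideanSpace ℝ (Fin (m+1)))).real univ = (m+1:ℕ) * vn := by
    rw [Measure.toSphere_real_apply_univ, hfr]
  have hρ : 0 < 1 - ‖x‖^2 := by nlinarith [norm_nonneg x]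
  have hk : ∀ l : EuclideanSpace ℝ (Fin (m+1)), ‖l‖ = 1 →
      ∫ ω, |dPt (m+1) x l (ω:EuclideanSpace ℝ (Fin (m+1)))| ∂(sg (EuclideanSpace ℝ (Fin (m+1))))
      ≤ (m+1:ℕ)/(1-‖x‖^2) * (vm * (m * I)) := by
    intro l hl1
    have := kern (((m:ℝ)-1)/2) (by linarith) (by rw [hfr]; push_cast; ring) hx he hxe hl1
    rw [hfr, hcx] at this
    exact this
  set C := ((((m+1:ℕ):ℝ)-1) * vm / vn * I * (1 / (1 - ‖x‖^2))) * M with hC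
  have hRb : ∀ R : ℝ, 0 < R → R < 1 → ∀ l : EuclideanSpace ℝ (Fin (m+1)), ‖l‖ = 1 →
      |R * fderiv ℝ u (R • x) l| ≤ C := by
    intro R hR hR1 l hl1
    have hmem : ∀ y ∈ closedBall (0:EuclideanSpace ℝ (Fin (m+1))) 1,
        R • y ∈ ball (0:EuclideanSpace ℝ (Fin (m+1))) 1 := by
      intro y hy
      have : ‖y‖ ≤ 1 := by simpa using hy
      simp only [mem_ball_zero_iff, norm_smul, Real.norm_eq_abs, abs_of_pos hR]
      nlinarith [norm_nonneg y]
    have hxm := hmem x (by simpa using hx.le)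
    have hd := (hc.contDiffAt (isOpen_ball.mem_nhds hxm)).differentiableAt (by norm_num)
    have h2 := dil_line u R x l hd
    have h3 := line_bound (EuclideanSpace.basisFun (Fin (m+1)) ℝ) (fun y => u (R • y))
      (hc.continuousOn.comp (by fun_prop) hmem) (dil_harm _ u hc hl R hR hR1) M
      (fun y hy => hb _ (hmem y hy)) x hx l _ h2
    rw [hfr, hsg] at h3
    have h4 := h3.trans (mul_le_mul_of_nonneg_left (hk l hl1) hM)
    have hpos : (0:ℝ) < (m+1:ℕ) * vn := by positivity
    rw [← le_div_iff₀' hpos] at h4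
    refine h4.trans (le_of_eq ?_)
    rw [hC]
    push_cast
    have : (m:ℝ) + 1 ≠ 0 := by positivity
    field_simp
    ring
  have hlim : ∀ l : EuclideanSpace ℝ (Fin (m+1)), ‖l‖ = 1 → |fderiv ℝ u x l| ≤ C := by
    intro l hl1
    have hxm : x ∈ ball (0:EuclideanSpace ℝ (Fin (m+1))) 1 := by simpa using hx
    have hcd := hc.contDiffAt (isOpen_ball.mem_nhds hxm)
    have hcf : ContinuousAt (fderiv ℝ u) x :=
      (hcd.fderiv_right (m := 1) (by norm_num)).continuousAt
    have hcR : ContinuousAt (fun R : ℝ => |R * fderiv ℝ u (R • x) l|) 1 := by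
      have h1 : ContinuousAt (fun R : ℝ => fderiv ℝ u (R • x)) 1 := by
        apply ContinuousAt.comp_of_eq (g := fderiv ℝ u) (y := x) hcf (by fun_prop) (by simp)
      exact (continuousAt_id.mul (h1.clm_apply continuousAt_const)).abs
    have h5 := (hcR.tendsto).mono_left (nhdsWithin_le_nhds (s := Iio (1:ℝ)))
    simp only [one_smul, one_mul] at h5
    refine le_of_tendsto h5 ?_
    filter_upwards [Ioo_mem_nhdsLT (show (0:ℝ) < 1 by norm_num)] with R hR
    exact hRb R hR.1 hR.2 l hl1
  have hC0 : 0 ≤ C := (abs_nonneg _).trans (hlim e he)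
  refine ContinuousLinearMap.opNorm_le_bound _ hC0 fun v => ?_
  by_cases hv : v = 0
  · simp [hv]
  · have h6 := hlim (‖v‖⁻¹ • v) (norm_smul_inv_norm hv)
    have hvp : 0 < ‖v‖ := norm_pos_iff.2 hv
    rw [map_smul, smul_eq_mul, abs_mul, abs_of_pos (by positivity), inv_mul_le_iff₀ hvp] at h6
    rw [Real.norm_eq_abs]
    linarith

end Final
end Khav

theorem khavinson_gradient_estimate (n : Nat) (hn : 3 ≤ n)
    (u : EuclideanSpace Real (Fin n) -> Real)
    (hu : IsHarmonicOn u (Metric.ball 0 1))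
    (M : Real) (hb : ∀ y ∈ Metric.ball (0 : EuclideanSpace Real (Fin n)) 1, |u y| ≤ M)
    (x : EuclideanSpace Real (Fin n)) (hx : x ∈ Metric.ball (0 : EuclideanSpace Real (Fin n)) 1) :
    ‖fderiv Real u x‖
      ≤ ((n:Real)-1) * unitBallVol (n-1) / unitBallVol n
          * (∫ t in (-1:Real)..1, |t - ((n:Real)-2)/n * ‖x‖| * (1 - t^2) ^ (((n:Real)-3)/2)
              * (1 - 2*t*‖x‖ + ‖x‖^2) ^ (-(((n:Real)-2)/2)))
          * (1 / (1 - ‖x‖^2)) * M := by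
  obtain ⟨m, rfl⟩ : ∃ m, n = m + 1 := ⟨n - 1, by omega⟩
  exact Khav.final m (by omega) u hu.1 hu.2 M hb x (by simpa using hx)
end

section
/- For every z in the open unit disk and every real-valued harmonic function u on the disk with |u| < 1, |∇u(z)| ≤ (4/π) · (1 - |u(z)|²)/(1 - |z|²). -/
open Complex in
theorem kv_schwarz_pick (E : ℂ → ℂ) (hE : DifferentiableOn ℂ E (Metric.ball 0 1))
    (hpos : ∀ z ∈ Metric.ball (0:ℂ) 1, 0 < (E z).re) (a : ℂ) (ha : a ∈ Metric.ball (0:ℂ) 1) :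
    ‖deriv E a‖ * (1 - ‖a‖^2) ≤ 2 * (E a).re := by
  have ha1 : ‖a‖ < 1 := by simpa using ha
  set c := (starRingEnd ℂ) a with hc
  have hcn : ‖c‖ = ‖a‖ := by simp [hc]
  have hden : ∀ ζ ∈ Metric.ball (0:ℂ) 1, 1 + c * ζ ≠ 0 := by
    intro ζ hζ h
    have hζ1 : ‖ζ‖ < 1 := by simpa using hζ
    have h1 : c * ζ = -1 := by linear_combination h
    have h2 : ‖c‖ * ‖ζ‖ = 1 := by rw [← norm_mul, h1]; simp
    rw [hcn] at h2
    nlinarith [norm_nonneg a, norm_nonneg ζ]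
  set φ : ℂ → ℂ := fun ζ => (ζ + a) / (1 + c * ζ) with hφ
  have hφmap : Set.MapsTo φ (Metric.ball 0 1) (Metric.ball 0 1) := by
    intro ζ hζ
    have hζ1 : ‖ζ‖ < 1 := by simpa using hζ
    have hd := hden ζ hζ
    have : ‖ζ + a‖ < ‖1 + c * ζ‖ := by
      apply lt_of_pow_lt_pow_left₀ 2 (norm_nonneg _)
      have e1 : ‖1 + c * ζ‖^2 - ‖ζ + a‖^2 = (1 - ‖a‖^2) * (1 - ‖ζ‖^2) := by
        simp only [← Complex.normSq_eq_norm_sq, Complex.normSq_apply, hc]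
        simp
        ring
      have : 0 < (1 - ‖a‖^2) * (1 - ‖ζ‖^2) := by
        apply mul_pos <;> nlinarith [norm_nonneg a, norm_nonneg ζ]
      linarith
    simp only [hφ, Metric.mem_ball, dist_zero_right, norm_div]
    rw [div_lt_one (norm_pos_iff.2 hd)]
    exact this
  have hφd : DifferentiableOn ℂ φ (Metric.ball 0 1) := by
    apply DifferentiableOn.div (by fun_prop) (by fun_prop) hden
  have hφ0 : φ 0 = a := by simp [hφ]
  have hφderiv : HasDerivAt φ (1 - c * a) 0 := by
    have h := ((hasDerivAt_id (0:ℂ)).add_const a).div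
      (((hasDerivAt_id (0:ℂ)).const_mul c).const_add 1) (by simp)
    refine h.congr_deriv ?_
    simp
    ring
  set w := E a with hw
  set cw := (starRingEnd ℂ) w with hcw
  have hwpos : 0 < w.re := hpos a ha
  have hd2 : ∀ v : ℂ, 0 < v.re → v + cw ≠ 0 := by
    intro v hv h
    have := congrArg Complex.re h
    simp [hcw] at this
    linarith
  set G : ℂ → ℂ := fun ζ => (E (φ ζ) - w) / (E (φ ζ) + cw) with hG
  have hEφ : DifferentiableOn ℂ (fun ζ => E (φ ζ)) (Metric.ball 0 1) := hE.comp hφd hφmap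
  have hGd : DifferentiableOn ℂ G (Metric.ball 0 1) :=
    (hEφ.sub_const w).div (hEφ.add_const cw) (fun ζ hζ => hd2 _ (hpos _ (hφmap hζ)))
  have hG0 : G 0 = 0 := by simp [hG, hφ0, hw]
  have hGm : Set.MapsTo G (Metric.ball 0 1) (Metric.closedBall (G 0) 1) := by
    intro ζ hζ
    rw [hG0]
    have hp := hpos _ (hφmap hζ)
    simp only [hG, Metric.mem_closedBall, dist_zero_right, norm_div]
    rw [div_le_one (norm_pos_iff.2 (hd2 _ hp))]
    apply le_of_sq_le_sq _ (norm_nonneg _)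
    generalize E (φ ζ) = v at hp
    simp only [← Complex.normSq_eq_norm_sq, Complex.normSq_apply, hcw]
    simp
    nlinarith [mul_pos hp hwpos]
  have hle := Complex.norm_deriv_le_one_of_mapsTo_ball hGd hGm one_pos
  have hEa : HasDerivAt E (deriv E a) (φ 0) := by
    rw [hφ0]
    exact (hE.differentiableAt (Metric.isOpen_ball.mem_nhds ha)).hasDerivAt
  have hcomp : HasDerivAt (fun ζ => E (φ ζ)) (deriv E a * (1 - c * a)) 0 := hEa.comp 0 hφderiv
  have hGder := (hcomp.sub_const w).div (hcomp.add_const cw) (hd2 _ (by rw [hφ0]; exact hwpos))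
  have hsum : w + cw = ((2 * w.re : ℝ) : ℂ) := by
    rw [hcw, Complex.add_conj]
  have hca : 1 - c * a = ((1 - ‖a‖^2 : ℝ) : ℂ) := by
    rw [hc, mul_comm, Complex.mul_conj, Complex.normSq_eq_norm_sq]; push_cast; ring
  have hd3 : deriv G 0 = deriv E a * ((1 - ‖a‖^2 : ℝ) : ℂ) / ((2 * w.re : ℝ) : ℂ) := by
    have h3 : w + cw ≠ 0 := hd2 _ hwpos
    rw [← hca, ← hsum]
    refine hGder.deriv.trans ?_
    simp only [hφ0, ← hw]
    field_simp
    ring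
  rw [hd3, norm_div, norm_mul, Complex.norm_real, Complex.norm_real, Real.norm_of_nonneg,
    Real.norm_of_nonneg, div_le_one] at hle
  · exact hle
  · positivity
  · positivity
  · nlinarith [norm_nonneg a]

theorem kv_cos (x : ℝ) (hx : |x| < 1) : Real.cos (Real.pi / 2 * x) ≤ 1 - x^2 := by
  wlog h : 0 ≤ x generalizing x
  · have := this (-x) (by simpa using hx) (by linarith)
    simpa using this
  have hx1 : x < 1 := (abs_lt.1 hx).2
  have hpi := Real.pi_pos
  have hs : x * (√2 / 2) ≤ Real.sin (Real.pi / 4 * x) := by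
    have hm0 : (0:ℝ) ∈ Set.Icc 0 Real.pi := ⟨le_refl _, hpi.le⟩
    have hm1 : Real.pi / 4 ∈ Set.Icc 0 Real.pi := ⟨by positivity, by linarith⟩
    have := strictConcaveOn_sin_Icc.concaveOn.2 hm0 hm1 (sub_nonneg.2 hx1.le) h
      (sub_add_cancel 1 x)
    simp only [smul_eq_mul, Real.sin_zero, Real.sin_pi_div_four] at this
    rw [mul_zero, zero_add, zero_add, mul_comm x (Real.pi / 4)] at this
    exact this
  have : Real.cos (Real.pi / 2 * x) = 1 - 2 * Real.sin (Real.pi / 4 * x)^2 := by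
    rw [show Real.pi / 2 * x = 2 * (Real.pi / 4 * x) by ring, Real.cos_two_mul]
    linarith [Real.sin_sq_add_cos_sq (Real.pi / 4 * x)]
  rw [this]
  have h2 : (x * (√2 / 2))^2 ≤ Real.sin (Real.pi / 4 * x)^2 := by gcongr
  have h3 : (x * (√2 / 2))^2 = x^2/2 := by
    rw [mul_pow, div_pow, Real.sq_sqrt (by norm_num)]; ring
  linarith

open Complex in
theorem kv_deriv (F : ℂ → ℂ) (hF : DifferentiableOn ℂ F (Metric.ball 0 1))
    (hb : ∀ z ∈ Metric.ball (0:ℂ) 1, |(F z).re| < 1) (a : ℂ) (ha : a ∈ Metric.ball (0:ℂ) 1) :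
    ‖deriv F a‖ ≤ 4 / Real.pi * ((1 - (F a).re^2) / (1 - ‖a‖^2)) := by
  have hpi := Real.pi_pos
  have ha1 : ‖a‖ < 1 := by simpa using ha
  set k : ℂ := I * ((Real.pi / 2 : ℝ) : ℂ) with hk
  have hkn : ‖k‖ = Real.pi / 2 := by
    rw [hk, norm_mul, norm_I, Complex.norm_real, Real.norm_of_nonneg (by positivity), one_mul]
  have hre : ∀ v : ℂ, (exp (k * v)).re = ‖exp (k * v)‖ * Real.cos (Real.pi / 2 * v.re) := by
    intro v
    rw [Complex.exp_re, Complex.norm_exp]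
    congr 2
    simp [hk]
  have h := kv_schwarz_pick (fun z => exp (k * F z)) (by fun_prop) (by
    intro z hz
    rw [hre]
    have := abs_lt.1 (hb z hz)
    apply mul_pos (norm_pos_iff.2 (exp_ne_zero _))
    apply Real.cos_pos_of_mem_Ioo
    constructor <;> nlinarith) a ha
  have hd : HasDerivAt F (deriv F a) a :=
    (hF.differentiableAt (Metric.isOpen_ball.mem_nhds ha)).hasDerivAt
  rw [(hd.const_mul k).cexp.deriv, hre, norm_mul, norm_mul, hkn] at h
  have he : 0 < ‖exp (k * F a)‖ := norm_pos_iff.2 (exp_ne_zero _)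
  have hq : 0 < 1 - ‖a‖^2 := by nlinarith [norm_nonneg a]
  have h2 : Real.pi / 2 * ‖deriv F a‖ * (1 - ‖a‖^2) ≤ 2 * Real.cos (Real.pi / 2 * (F a).re) := by
    apply le_of_mul_le_mul_left _ he
    linarith
  have h3 := kv_cos _ (hb a ha)
  rw [div_mul_div_comm, le_div_iff₀ (by positivity)]
  nlinarith

open InnerProductSpace in
theorem kv_harm (u : EuclideanSpace Real (Fin 2) -> Real)
    (hu : IsHarmonicOn u (Metric.ball 0 1)) :
    HarmonicOnNhd (u ∘ Complex.orthonormalBasisOneI.repr) (Metric.ball 0 1) := by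
  set e := Complex.orthonormalBasisOneI.repr with he
  have hmem : ∀ x ∈ Metric.ball (0:ℂ) 1, e x ∈ Metric.ball (0 : EuclideanSpace Real (Fin 2)) 1 := by
    intro x hx
    simpa using hx
  have hC : ∀ y ∈ Metric.ball (0 : EuclideanSpace Real (Fin 2)) 1, ContDiffAt ℝ 2 u y :=
    fun y hy => hu.1.contDiffAt (Metric.isOpen_ball.mem_nhds hy)
  intro x hx
  refine ⟨(hC _ (hmem x hx)).comp x e.contDiff.contDiffAt, ?_⟩
  filter_upwards [Metric.isOpen_ball.mem_nhds hx] with y hy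
  rw [laplacian_eq_iteratedFDeriv_orthonormalBasis _ Complex.orthonormalBasisOneI]
  have hy' := hmem y hy
  have h2 := hu.2 _ hy'
  have hdd : DifferentiableAt ℝ (fderiv ℝ u) (e y) :=
    ((hC _ hy').fderiv_right (m := 1) (by norm_num)).differentiableAt (by norm_num)
  simp only [Pi.zero_apply]
  rw [← h2]
  refine Finset.sum_congr rfl fun i _ => ?_
  have h3 : iteratedFDeriv ℝ 2 (u ∘ e) y = (iteratedFDeriv ℝ 2 u (e y)).compContinuousLinearMap
    (fun _ => (e.toContinuousLinearEquiv : ℂ →L[ℝ] EuclideanSpace ℝ (Fin 2))) := by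
    have := e.toContinuousLinearEquiv.iteratedFDerivWithin_comp_right (𝕜 := ℝ) u
      (s := Set.univ) uniqueDiffOn_univ (x := y) (Set.mem_univ _) 2
    simp only [Set.preimage_univ, iteratedFDerivWithin_univ] at this
    exact this
  rw [h3]
  simp only [ContinuousMultilinearMap.compContinuousLinearMap_apply, iteratedFDeriv_two_apply]
  rw [fderiv_clm_apply hdd (by fun_prop)]
  have h4 : e (Complex.orthonormalBasisOneI i) = EuclideanSpace.single i 1 :=
    OrthonormalBasis.repr_self _ i
  simp [← h4]

theorem kalaj_vuorinen (u : EuclideanSpace Real (Fin 2) -> Real)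
    (hu : IsHarmonicOn u (Metric.ball 0 1))
    (hb : ∀ y ∈ Metric.ball (0 : EuclideanSpace Real (Fin 2)) 1, |u y| < 1)
    (z : EuclideanSpace Real (Fin 2)) (hz : z ∈ Metric.ball (0 : EuclideanSpace Real (Fin 2)) 1) :
    ‖fderiv Real u z‖ ≤ 4 / Real.pi * ((1 - (u z)^2) / (1 - ‖z‖^2)) := by
  obtain ⟨F, hF, hFu⟩ := (kv_harm u hu).exists_analyticOnNhd_ball_re_eq
  set e := Complex.orthonormalBasisOneI.repr with he
  have hmem : ∀ y ∈ Metric.ball (0 : EuclideanSpace Real (Fin 2)) 1,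
      e.symm y ∈ Metric.ball (0:ℂ) 1 := by
    intro x hx
    simpa using hx
  have hue : ∀ y ∈ Metric.ball (0 : EuclideanSpace Real (Fin 2)) 1, (F (e.symm y)).re = u y := by
    intro y hy
    have := hFu (hmem y hy)
    simpa using this
  have hFd : DifferentiableOn ℂ F (Metric.ball 0 1) := hF.differentiableOn
  have key := kv_deriv F hFd (by
    intro x hx
    have h1 := hFu hx
    simp only [Function.comp] at h1
    rw [h1]
    exact hb _ (by simpa using hx)) (e.symm z) (hmem z hz)
  rw [hue z hz, LinearIsometryEquiv.norm_map] at key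
  refine le_trans ?_ key
  have hda : HasDerivAt F (deriv F (e.symm z)) (e.symm z) :=
    (hFd.differentiableAt (Metric.isOpen_ball.mem_nhds (hmem z hz))).hasDerivAt
  have h1 := hda.hasFDerivAt.restrictScalars ℝ
  have h2 := h1.comp z (e.symm.toContinuousLinearEquiv.hasFDerivAt)
  have h3 := Complex.reCLM.hasFDerivAt.comp z h2
  have h4 : u =ᶠ[nhds z] (Complex.reCLM ∘ (F ∘ e.symm.toContinuousLinearEquiv)) := by
    filter_upwards [Metric.isOpen_ball.mem_nhds hz] with y hy
    exact (hue y hy).symm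
  rw [(h3.congr_of_eventuallyEq h4).fderiv]
  refine ContinuousLinearMap.opNorm_le_bound _ (norm_nonneg _) fun v => ?_
  refine (Complex.abs_re_le_norm _).trans ?_
  simp [mul_comm]
end
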